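/- arXiv:1108.4364 — 4 statements merged into one kernel-verified Lean document; each statement's English description precedes it below -/
import Mathlib

section
/- There exist ε > 0 and r₀ > 0 such that for all 0 < r ≤ r₀ and all x ∈ ℝ, r·H_I(r,x) ≤ π − ε·r. -/
open Real

/-- The annulus function `J(r,x) = (π²/(2r²)) ∑_{k ∈ ℤ} cosh(π(x+2kπ)/(2r))⁻²`. -/
noncomputable def Jfun (r x : ℝ) : ℝ :=
  (π ^ 2 / (2 * r ^ 2)) * ∑' k : ℤ, ((Real.cosh (π * (x + 2 * (k : ℝ) * π) / (2 * r))) ^ 2)⁻¹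

/-- `H_I(r,x) = ∫_0^x (J(r,y) - 1/r) dy`. -/
noncomputable def HI (r x : ℝ) : ℝ := ∫ y in (0:ℝ)..x, (Jfun r y - 1 / r)

open Filter Topology Set

theorem hasDerivAt_tanh_inv_cosh_sq (x : ℝ) :
    HasDerivAt Real.tanh ((Real.cosh x ^ 2)⁻¹) x := by
  have h : Real.tanh = fun y => Real.sinh y / Real.cosh y :=
    funext Real.tanh_eq_sinh_div_cosh
  rw [h]
  convert! (Real.hasDerivAt_sinh x).div (Real.hasDerivAt_cosh x) (Real.cosh_pos x).ne' using 1
  rw [inv_eq_one_div, ← Real.cosh_sq_sub_sinh_sq x]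
  ring

theorem strictMono_tanh_real : StrictMono Real.tanh :=
  strictMono_of_hasDerivAt_pos hasDerivAt_tanh_inv_cosh_sq
    fun x => inv_pos.2 (pow_pos (Real.cosh_pos x) 2)

theorem tendsto_tanh_atTop_one : Tendsto Real.tanh atTop (𝓝 1) := by
  have h : Real.tanh = fun x => (1 - exp (-(2 * x))) / (1 + exp (-(2 * x))) := by
    funext x
    have hx : exp (-(2 * x)) = exp (-x) * exp (-x) := by rw [← Real.exp_add]; ring_nf
    have hx' : exp x * exp (-x) = 1 := by rw [← Real.exp_add]; simp
    rw [Real.tanh_eq, hx, div_eq_div_iff (by positivity) (by positivity)]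
    linear_combination (2 * exp (-x)) * hx'
  have he : Tendsto (fun x : ℝ => exp (-(2 * x))) atTop (𝓝 0) :=
    Real.tendsto_exp_neg_atTop_nhds_zero.comp (tendsto_id.const_mul_atTop two_pos)
  have hlim : Tendsto (fun x : ℝ => (1 - exp (-(2 * x))) / (1 + exp (-(2 * x)))) atTop
      (𝓝 ((1 - 0) / (1 + 0))) :=
    (he.const_sub 1).div (he.const_add 1) (by norm_num)
  rw [h]
  simpa using hlim

theorem tendsto_tanh_atBot_neg_one : Tendsto Real.tanh atBot (𝓝 (-1)) := by
  simpa [Function.comp_def] using (tendsto_tanh_atTop_one.comp tendsto_neg_atBot_atTop).neg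

theorem hasSum_int_sub_of_monotone {u : ℤ → ℝ} (hu : Monotone u) {L M : ℝ}
    (hL : Tendsto u atTop (𝓝 L)) (hM : Tendsto u atBot (𝓝 M)) :
    HasSum (fun k => u (k + 1) - u k) (L - M) := by
  have hpos : HasSum (fun n : ℕ => u ((n : ℤ) + 1) - u n) (L - u 0) := by
    refine (hasSum_iff_tendsto_nat_of_nonneg (fun n => sub_nonneg.2 (hu (by lia))) _).2 ?_
    have h := (hL.comp tendsto_natCast_atTop_atTop).sub_const (u 0)
    refine h.congr fun n => ?_
    simpa using (Finset.sum_range_sub (fun n : ℕ => u n) n).symm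
  have hneg : HasSum (fun n : ℕ => u (-((n : ℤ) + 1) + 1) - u (-((n : ℤ) + 1))) (u 0 - M) := by
    refine (hasSum_iff_tendsto_nat_of_nonneg (fun n => sub_nonneg.2 (hu (by lia))) _).2 ?_
    have h := (hM.comp (tendsto_neg_atTop_atBot.comp tendsto_natCast_atTop_atTop)).const_sub (u 0)
    refine h.congr fun n => ?_
    simpa using (Finset.sum_range_sub' (fun n : ℕ => u (-(n : ℤ))) n).symm
  rw [← sub_add_sub_cancel L (u 0) M]
  exact HasSum.of_nat_of_neg_add_one (f := fun k => u (k + 1) - u k) hpos hneg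

theorem inv_cosh_sq_le (y : ℝ) : (Real.cosh y ^ 2)⁻¹ ≤ (1 + y ^ 2)⁻¹ := by
  have h : y ^ 2 ≤ Real.sinh y ^ 2 := by
    rw [sq_le_sq, Real.abs_sinh]
    exact Real.self_le_sinh_iff.2 (abs_nonneg y)
  rw [Real.cosh_sq]
  exact inv_anti₀ (by positivity) (by linarith)

/-- The `k`-th term of the series defining `Jfun r x`. -/
noncomputable def Jterm (r : ℝ) (k : ℤ) (x : ℝ) : ℝ :=
  ((Real.cosh (π * (x + 2 * (k : ℝ) * π) / (2 * r))) ^ 2)⁻¹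

theorem Jterm_nonneg (r : ℝ) (k : ℤ) (x : ℝ) : 0 ≤ Jterm r k x := by
  unfold Jterm; positivity

theorem continuous_Jterm (r : ℝ) (k : ℤ) : Continuous (Jterm r k) := by
  unfold Jterm
  refine Continuous.inv₀ (by fun_prop) fun x => (pow_pos (Real.cosh_pos _) 2).ne'

theorem Jterm_le {r : ℝ} (k : ℤ) {x : ℝ} (hx : |x| ≤ π) :
    Jterm r k x ≤ (1 + (π ^ 2 / (2 * r) * k) ^ 2)⁻¹ := by
  refine (inv_cosh_sq_le _).trans ?_
  have hk : (π * k) ^ 2 ≤ (x + 2 * k * π) ^ 2 := by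
    obtain ⟨h₁, h₂⟩ := abs_le.1 hx
    rcases lt_trichotomy k 0 with h | rfl | h
    · have h' : (k : ℝ) ≤ -1 := by exact_mod_cast (by lia : k ≤ -1)
      rw [sq_le_sq, abs_of_neg (by nlinarith [pi_pos]), abs_of_neg (by nlinarith [pi_pos])]
      nlinarith [pi_pos]
    · simp [sq_nonneg]
    · have h' : (1 : ℝ) ≤ k := by exact_mod_cast h
      rw [sq_le_sq, abs_of_pos (by positivity), abs_of_nonneg (by nlinarith [pi_pos])]
      nlinarith [pi_pos]
  have h : (π ^ 2 / (2 * r) * k) ^ 2 ≤ (π * (x + 2 * k * π) / (2 * r)) ^ 2 :=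
    calc (π ^ 2 / (2 * r) * k) ^ 2 = (π / (2 * r)) ^ 2 * (π * k) ^ 2 := by ring
      _ ≤ (π / (2 * r)) ^ 2 * (x + 2 * k * π) ^ 2 := by gcongr
      _ = _ := by ring
  exact inv_anti₀ (by positivity) (by linarith)

theorem summable_inv_one_add_mul_sq {c : ℝ} (hc : 0 < c) :
    Summable fun k : ℤ => (1 + (c * k) ^ 2)⁻¹ := by
  have h : Summable fun k : ℤ => (c ^ 2)⁻¹ * (1 / (k : ℝ) ^ 2) :=
    (Real.summable_one_div_int_pow.2 one_lt_two).mul_left _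
  refine h.of_norm_bounded_eventually ?_
  filter_upwards [(Set.finite_singleton (0 : ℤ)).compl_mem_cofinite] with k hk
  have hk' : (k : ℝ) ≠ 0 := by exact_mod_cast hk
  rw [Real.norm_of_nonneg (by positivity), one_div, ← mul_inv, ← mul_pow]
  gcongr
  linarith

theorem summable_Jterm {r : ℝ} (hr : 0 < r) {x : ℝ} (hx : |x| ≤ π) :
    Summable fun k => Jterm r k x :=
  (summable_inv_one_add_mul_sq (by positivity)).of_nonneg_of_le
    (fun k => Jterm_nonneg r k x) fun k => Jterm_le k hx

theorem Jfun_eq (r x : ℝ) : Jfun r x = π ^ 2 / (2 * r ^ 2) * ∑' k, Jterm r k x := rfl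

theorem Jfun_nonneg (r x : ℝ) : 0 ≤ Jfun r x :=
  mul_nonneg (by positivity) (tsum_nonneg fun k => Jterm_nonneg r k x)

theorem Jterm_zero_le_Jfun {r : ℝ} (hr : 0 < r) {x : ℝ} (hx : |x| ≤ π) :
    π ^ 2 / (2 * r ^ 2) * Jterm r 0 x ≤ Jfun r x :=
  mul_le_mul_of_nonneg_left
    ((summable_Jterm hr hx).le_tsum 0 fun k _ => Jterm_nonneg r k x) (by positivity)

theorem Jfun_neg (r x : ℝ) : Jfun r (-x) = Jfun r x := by
  rw [Jfun_eq, Jfun_eq, ← (Equiv.neg ℤ).tsum_eq]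
  congr 2 with k
  simp only [Jterm, Equiv.neg_apply, Int.cast_neg]
  rw [← Real.cosh_neg]
  ring_nf

theorem Jfun_periodic (r : ℝ) : Function.Periodic (Jfun r) (2 * π) := by
  intro x
  rw [Jfun_eq, Jfun_eq, ← (Equiv.addRight (1 : ℤ)).tsum_eq (fun k => Jterm r k x)]
  congr 2 with k
  simp only [Jterm, Equiv.coe_addRight, Int.cast_add, Int.cast_one]
  ring_nf

theorem continuousOn_Jfun {r : ℝ} (hr : 0 < r) : ContinuousOn (Jfun r) (Icc (-π) π) := by
  refine continuousOn_const.mul (continuousOn_tsum (fun k => (continuous_Jterm r k).continuousOn)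
    (summable_inv_one_add_mul_sq (c := π ^ 2 / (2 * r)) (by positivity)) fun k x hx => ?_)
  change ‖Jterm r k x‖ ≤ _
  rw [Real.norm_of_nonneg (Jterm_nonneg r k x)]
  exact Jterm_le k (abs_le.2 hx)

theorem intervalIntegrable_Jfun {r : ℝ} (hr : 0 < r) (a b : ℝ) :
    IntervalIntegrable (Jfun r) MeasureTheory.volume a b := by
  refine (Jfun_periodic r).intervalIntegrable (t := -π) (by positivity) ?_ a b
  refine ContinuousOn.intervalIntegrable_of_Icc (by linarith [pi_pos]) ?_
  convert continuousOn_Jfun hr using 2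
  ring

theorem integral_Jterm {r : ℝ} (hr : 0 < r) (k : ℤ) (a b : ℝ) :
    ∫ x in a..b, Jterm r k x = 2 * r / π * Real.tanh (π * (b + 2 * k * π) / (2 * r)) -
      2 * r / π * Real.tanh (π * (a + 2 * k * π) / (2 * r)) := by
  refine intervalIntegral.integral_eq_sub_of_hasDerivAt
    (f := fun x => 2 * r / π * Real.tanh (π * (x + 2 * k * π) / (2 * r))) (fun x _ => ?_)
    ((continuous_Jterm r k).intervalIntegrable a b)
  have h : HasDerivAt (fun x : ℝ => π * (x + 2 * k * π) / (2 * r)) (π * 1 / (2 * r)) x :=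
    (((hasDerivAt_id x).add_const _).const_mul π).div_const _
  convert! ((hasDerivAt_tanh_inv_cosh_sq _).comp x h).const_mul (2 * r / π) using 1
  have := pi_pos.ne'
  unfold Jterm
  field_simp

theorem hasSum_integral_Jterm {r : ℝ} (hr : 0 < r) :
    HasSum (fun k => ∫ x in (-π)..π, Jterm r k x) (∫ x in (-π)..π, ∑' k, Jterm r k x) := by
  refine intervalIntegral.hasSum_intervalIntegral_of_summable_norm
    (f := fun k => ⟨Jterm r k, continuous_Jterm r k⟩) ?_
  refine (summable_inv_one_add_mul_sq (c := π ^ 2 / (2 * r)) (by positivity)).of_nonneg_of_le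
    (fun k => norm_nonneg _) fun k => ?_
  refine (ContinuousMap.norm_le _ (by positivity)).2 fun x => ?_
  have hx : (x : ℝ) ∈ Icc (-π) π := (uIcc_of_le (by linarith [pi_pos])).subset x.2
  change ‖Jterm r k x‖ ≤ _
  rw [Real.norm_of_nonneg (Jterm_nonneg r k x)]
  exact Jterm_le k (abs_le.2 hx)

theorem integral_tsum_Jterm {r : ℝ} (hr : 0 < r) :
    ∫ x in (-π)..π, ∑' k, Jterm r k x = 4 * r / π := by
  refine (hasSum_integral_Jterm hr).unique ?_
  have hb : 0 < π ^ 2 / (2 * r) := by positivity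
  set u : ℤ → ℝ := fun k => 2 * r / π * Real.tanh (π ^ 2 / (2 * r) * (2 * k - 1)) with hu
  have hmono : Monotone u := fun i j hij => by
    have : (i : ℝ) ≤ j := by exact_mod_cast hij
    refine mul_le_mul_of_nonneg_left (strictMono_tanh_real.monotone ?_) (by positivity)
    gcongr
  have htop : Tendsto u atTop (𝓝 (2 * r / π * 1)) :=
    (tendsto_tanh_atTop_one.comp ((tendsto_atTop_add_const_right _ (-1)
      (tendsto_intCast_atTop_atTop.const_mul_atTop two_pos)).const_mul_atTop hb)).const_mul _
  have hbot : Tendsto u atBot (𝓝 (2 * r / π * (-1))) :=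
    (tendsto_tanh_atBot_neg_one.comp ((tendsto_atBot_add_const_right _ (-1)
      ((tendsto_intCast_atBot_iff.2 tendsto_id).const_mul_atBot two_pos)).const_mul_atBot
        hb)).const_mul _
  convert hasSum_int_sub_of_monotone hmono htop hbot using 1
  · funext k
    rw [integral_Jterm hr, hu]
    push_cast
    congr 3 <;> ring
  · ring

theorem integral_Jfun_neg_pi_pi {r : ℝ} (hr : 0 < r) :
    ∫ x in (-π)..π, Jfun r x = 2 * π / r := by
  simp_rw [Jfun_eq]
  rw [intervalIntegral.integral_const_mul, integral_tsum_Jterm hr]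
  have := pi_pos.ne'
  field_simp
  ring

theorem integral_Jfun_zero_pi {r : ℝ} (hr : 0 < r) : ∫ x in (0 : ℝ)..π, Jfun r x = π / r := by
  have hsymm : ∫ x in (-π)..0, Jfun r x = ∫ x in (0 : ℝ)..π, Jfun r x := by
    simpa [Jfun_neg] using
      (intervalIntegral.integral_comp_neg (a := 0) (b := π) (Jfun r)).symm
  have hsplit := intervalIntegral.integral_add_adjacent_intervals
    (intervalIntegrable_Jfun hr (-π) 0) (intervalIntegrable_Jfun hr 0 π)
  have : 2 * π / r = 2 * (π / r) := by ring
  linarith [integral_Jfun_neg_pi_pi hr]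

theorem mul_HI_eq {r : ℝ} (hr : 0 < r) (x : ℝ) :
    r * HI r x = r * (∫ y in (0 : ℝ)..x, Jfun r y) - x := by
  rw [HI, intervalIntegral.integral_sub (intervalIntegrable_Jfun hr 0 x) (by simp)]
  simp only [intervalIntegral.integral_const, smul_eq_mul]
  field_simp
  ring

theorem HI_periodic {r : ℝ} (hr : 0 < r) : Function.Periodic (HI r) (2 * π) := by
  intro x
  have hsplit := intervalIntegral.integral_add_adjacent_intervals
    (intervalIntegrable_Jfun hr 0 x) (intervalIntegrable_Jfun hr x (x + 2 * π))
  have hperiod : ∫ y in x..(x + 2 * π), Jfun r y = 2 * π / r := by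
    rw [(Jfun_periodic r).intervalIntegral_add_eq x (-π), show -π + 2 * π = π by ring,
      integral_Jfun_neg_pi_pi hr]
  refine mul_left_cancel₀ hr.ne' ?_
  rw [mul_HI_eq hr, mul_HI_eq hr, ← hsplit, hperiod]
  field_simp
  ring

/-- The integral of `Jfun` is bounded below by that of its central term. -/
theorem tanh_sub_tanh_le_integral_Jfun {r : ℝ} (hr : 0 < r) {a b : ℝ} (ha : -π ≤ a)
    (hab : a ≤ b) (hb : b ≤ π) :
    π * Real.tanh (π * b / (2 * r)) - π * Real.tanh (π * a / (2 * r)) ≤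
      r * ∫ x in a..b, Jfun r x := by
  have h : ∫ x in a..b, π ^ 2 / (2 * r ^ 2) * Jterm r 0 x ≤ ∫ x in a..b, Jfun r x :=
    intervalIntegral.integral_mono_on hab
      (((continuous_Jterm r 0).const_mul _).intervalIntegrable a b)
      (intervalIntegrable_Jfun hr a b) fun x hx =>
        Jterm_zero_le_Jfun hr (abs_le.2 ⟨ha.trans hx.1, hx.2.trans hb⟩)
  rw [intervalIntegral.integral_const_mul, integral_Jterm hr] at h
  have := mul_le_mul_of_nonneg_left h hr.le
  refine le_trans (le_of_eq ?_) this
  have := pi_pos.ne'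
  simp only [Int.cast_zero, mul_zero, zero_mul, add_zero]
  field_simp

theorem mul_HI_le_of_nonneg {r : ℝ} (hr : 0 < r) {x : ℝ} (h0 : 0 ≤ x) (hx : x ≤ π) :
    r * HI r x ≤ π - x -
      (π * Real.tanh (π * π / (2 * r)) - π * Real.tanh (π * x / (2 * r))) := by
  have hsplit := intervalIntegral.integral_add_adjacent_intervals
    (intervalIntegrable_Jfun hr 0 x) (intervalIntegrable_Jfun hr x π)
  rw [integral_Jfun_zero_pi hr] at hsplit
  have h := tanh_sub_tanh_le_integral_Jfun hr (by linarith [pi_pos]) hx le_rfl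
  have hπ : r * (π / r) = π := by field_simp
  rw [← hsplit, mul_add] at hπ
  rw [mul_HI_eq hr]
  linarith

theorem mul_HI_le_of_nonpos {r : ℝ} (hr : 0 < r) {x : ℝ} (h0 : x ≤ 0) (hx : -π ≤ x) :
    r * HI r x ≤ -x + π * Real.tanh (π * x / (2 * r)) := by
  have h := tanh_sub_tanh_le_integral_Jfun hr hx h0 pi_pos.le
  rw [intervalIntegral.integral_symm] at h
  simp only [mul_zero, zero_div, Real.tanh_zero] at h
  rw [mul_HI_eq hr]
  linarith

/-- There exist `ε > 0` and `r₀ > 0` such that for all `0 < r ≤ r₀` and all `x`,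
`r·H_I(r,x) ≤ π - ε r`. -/
theorem stmt5 : ∃ ε : ℝ, 0 < ε ∧ ∃ r₀ : ℝ, 0 < r₀ ∧
    ∀ r : ℝ, 0 < r → r ≤ r₀ → ∀ x : ℝ, r * HI r x ≤ π - ε * r := by
  have hπ := pi_gt_three
  have mono := strictMono_tanh_real.monotone
  set c := Real.tanh (π * π / 2) - Real.tanh (π / 2) with hc
  have hc0 : 0 < c := sub_pos.2 (strictMono_tanh_real (by nlinarith))
  set d := Real.tanh (π / 2) with hd
  have hd0 : 0 < d := by
    rw [hd, ← Real.tanh_zero]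
    exact strictMono_tanh_real (by positivity)
  have hc1 : c < 1 := by linarith [Real.tanh_lt_one (π * π / 2)]
  have hd1 : d < 1 := Real.tanh_lt_one _
  refine ⟨c * d, mul_pos hc0 hd0, 1, one_pos, fun r hr hr1 x => ?_⟩
  have hcd : c * d * r ≤ r := mul_le_of_le_one_left hr.le (by nlinarith)
  have hcd_c : c * d * r ≤ c := by
    rw [mul_assoc]; exact mul_le_of_le_one_right hc0.le (by nlinarith)
  have hcd_d : c * d * r ≤ d := by
    rw [mul_comm c, mul_assoc]; exact mul_le_of_le_one_right hd0.le (by nlinarith)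
  obtain ⟨y, hy, hxy⟩ := (HI_periodic hr).exists_mem_Ico (by positivity) x (-π)
  rw [hxy]
  rcases le_total 0 y with h0 | h0
  · have hyπ : y ≤ π := by linarith [hy.2]
    refine (mul_HI_le_of_nonneg hr h0 hyπ).trans ?_
    rcases le_total r y with h | h
    · have : Real.tanh (π * y / (2 * r)) ≤ Real.tanh (π * π / (2 * r)) := mono (by gcongr)
      nlinarith
    · have h₁ : Real.tanh (π * π / 2) ≤ Real.tanh (π * π / (2 * r)) :=
        mono (div_le_div_of_nonneg_left (by positivity) (by positivity) (by linarith))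
      have h₂ : Real.tanh (π * y / (2 * r)) ≤ d :=
        mono ((div_le_div_iff₀ (by positivity) two_pos).2 (by nlinarith))
      nlinarith
  · refine (mul_HI_le_of_nonpos hr h0 hy.1).trans ?_
    rcases le_total r (-y) with h | h
    · have h₁ : Real.tanh (π * y / (2 * r)) ≤ -d := by
        rw [hd, ← Real.tanh_neg, ← neg_div]
        exact mono ((div_le_div_iff₀ (by positivity) two_pos).2 (by nlinarith))
      nlinarith [hy.1]
    · have h₁ : Real.tanh (π * y / (2 * r)) ≤ 0 := by
        rw [← Real.tanh_zero]
        exact mono (div_nonpos_of_nonpos_of_nonneg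
          (mul_nonpos_of_nonneg_of_nonpos (by positivity) h0) (by positivity))
      nlinarith
end

section
/- There exists a constant c < ∞ such that for all r ≥ 1, | δ(r) − ( 1/(2r) − π²/(12r²) ) | ≤ c·e^{−r}. -/
open Real

/-- `δ(r) = 1/12 - (π²/(2r²)) ∑_{k≥1} sinh(kπ²/r)⁻²`. -/
noncomputable def deltaFun (r : ℝ) : ℝ :=
  1 / 12 - (π ^ 2 / (2 * r ^ 2)) *
    ∑' k : ℕ, ((Real.sinh (((k : ℝ) + 1) * π ^ 2 / r)) ^ 2)⁻¹

open scoped ArithmeticFunction.sigma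

/-- The Lambert series `∑_{n≥1} σ₁(n) e^{-ny}`. -/
noncomputable def sigmaExpSum (y : ℝ) : ℝ :=
  ∑' n : ℕ+, (σ 1 n : ℝ) * rexp (-y) ^ (n : ℕ)

lemma summable_sigma_mul_exp_pow {y : ℝ} (hy : 0 < y) :
    Summable fun n : ℕ+ ↦ (σ 1 n : ℝ) * rexp (-y) ^ (n : ℕ) := by
  have hq : ‖rexp (-y)‖ < 1 := by simpa using hy
  have h : Summable fun n : ℕ ↦ (σ 1 n : ℝ) * rexp (-y) ^ n := by
    refine .of_nonneg_of_le (fun n ↦ by positivity) (fun n ↦ ?_)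
      (summable_pow_mul_geometric_of_norm_lt_one 2 hq)
    gcongr
    exact_mod_cast ArithmeticFunction.sigma_le_pow_succ 1 n
  exact h.comp_injective PNat.coe_injective

/-- Comparison with `y = 1`: since `n ≥ 1`, `2rn ≥ r + n` for `r ≥ 1`. -/
lemma sigmaExpSum_two_mul_le {r : ℝ} (hr : 1 ≤ r) :
    sigmaExpSum (2 * r) ≤ sigmaExpSum 1 * rexp (-r) := by
  rw [sigmaExpSum, sigmaExpSum, ← tsum_mul_right]
  refine Summable.tsum_le_tsum (fun n ↦ ?_) (summable_sigma_mul_exp_pow (by linarith))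
    ((summable_sigma_mul_exp_pow one_pos).mul_right _)
  rw [mul_assoc, ← Real.exp_nat_mul, ← Real.exp_nat_mul, ← Real.exp_add]
  gcongr
  have hn : (1 : ℝ) ≤ (n : ℕ) := by exact_mod_cast n.pos
  nlinarith [mul_nonneg (sub_nonneg.2 hn) (sub_nonneg.2 hr)]

lemma sigmaExpSum_nonneg (y : ℝ) : 0 ≤ sigmaExpSum y :=
  tsum_nonneg fun n ↦ by positivity

lemma inv_sinh_sq_eq_tsum {x : ℝ} (hx : 0 < x) :
    (sinh x ^ 2)⁻¹ = 4 * ∑' n : ℕ+, (n : ℝ) * rexp (-(2 * x)) ^ (n : ℕ) := by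
  have hq : ‖rexp (-(2 * x))‖ < 1 := by simpa using hx
  have h := tsum_coe_mul_geometric_of_norm_lt_one hq
  rw [(hasSum_coe_mul_geometric_of_norm_lt_one hq).summable.tsum_eq_zero_add] at h
  simp only [Nat.cast_zero, zero_mul, zero_add] at h
  rw [tsum_pnat_eq_tsum_succ (f := fun n : ℕ ↦ (n : ℝ) * rexp (-(2 * x)) ^ n), h, sinh_eq]
  have h2 : rexp (-(2 * x)) = rexp (-x) ^ 2 := by rw [← Real.exp_nat_mul]; congr 1; push_cast; ring
  have h1 : rexp x = (rexp (-x))⁻¹ := by rw [Real.exp_neg, inv_inv]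
  have hlt : rexp (-x) < 1 := by simpa using hx
  have hpos := Real.exp_pos (-x)
  rw [h2, h1]
  generalize rexp (-x) = u at *
  have : 1 - u ^ 2 ≠ 0 := by nlinarith
  have h3 : u⁻¹ - u = (1 - u ^ 2) / u := by field_simp
  rw [h3]
  field_simp
  norm_num

lemma tsum_inv_sinh_sq_eq_sigmaExpSum {x : ℝ} (hx : 0 < x) :
    ∑' k : ℕ, (sinh (((k : ℝ) + 1) * x) ^ 2)⁻¹ = 4 * sigmaExpSum (2 * x) := by
  have hq : ‖rexp (-(2 * x))‖ < 1 := by simpa using hx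
  rw [sigmaExpSum, ← tsum_prod_pow_eq_tsum_sigma 1 hq,
    tsum_pnat_eq_tsum_succ
      (f := fun d : ℕ ↦ ∑' c : ℕ+, ((c : ℕ) : ℝ) ^ 1 * rexp (-(2 * x)) ^ (d * c : ℕ)),
    ← tsum_mul_left]
  refine tsum_congr fun k ↦ ?_
  rw [inv_sinh_sq_eq_tsum (by positivity)]
  congr 1
  refine tsum_congr fun n ↦ ?_
  rw [pow_one, pow_mul, ← Real.exp_nat_mul _ (k + 1)]
  congr 3
  push_cast
  ring

lemma G2_mul_I_eq_sigmaExpSum {t : ℝ} (z : UpperHalfPlane)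
    (hz : (z : ℂ) = t * Complex.I) :
    EisensteinSeries.G2 z = ((π ^ 2 / 3 - 8 * π ^ 2 * sigmaExpSum (2 * π * t) : ℝ) : ℂ) := by
  have hq : Complex.exp (2 * π * Complex.I * z) = (rexp (-(2 * π * t)) : ℂ) := by
    rw [hz, Complex.ofReal_exp]
    congr 1
    push_cast
    linear_combination (2 * π * t : ℂ) * Complex.I_sq
  rw [EisensteinSeries.G2_eq_tsum_cexp, hq, riemannZeta_two, sigmaExpSum]
  push_cast
  ring

/-- The transformation law of the weight-two Eisenstein series under `z ↦ -1/z` on the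
imaginary axis. -/
lemma sigmaExpSum_transform {t : ℝ} (ht : 0 < t) :
    1 - 24 * sigmaExpSum (2 * π * t) =
      6 / (π * t) - (1 - 24 * sigmaExpSum (2 * π * t⁻¹)) / t ^ 2 := by
  let z : UpperHalfPlane := ⟨t * Complex.I, by simpa using ht⟩
  have hz : (z : ℂ) = t * Complex.I := rfl
  have hS : ((ModularGroup.S • z : UpperHalfPlane) : ℂ) = (t⁻¹ : ℝ) * Complex.I := by
    rw [UpperHalfPlane.modular_S_smul]
    simp [hz, mul_comm]
  have h := EisensteinSeries.G2_S_transform z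
  rw [G2_mul_I_eq_sigmaExpSum z hz, G2_mul_I_eq_sigmaExpSum _ hS, hz] at h
  have ht' : (t : ℂ) ≠ 0 := by exact_mod_cast ht.ne'
  have hc : ((t * Complex.I) ^ 2 : ℂ)⁻¹ = ((-(t ^ 2)⁻¹ : ℝ) : ℂ) := by
    rw [mul_pow, Complex.I_sq]; push_cast; field_simp
  have hd : (-2 * π * Complex.I / (t * Complex.I) : ℂ) = ((-2 * π / t : ℝ) : ℂ) := by
    push_cast; field_simp
  rw [hc, hd] at h
  have h' : π ^ 2 / 3 - 8 * π ^ 2 * sigmaExpSum (2 * π * t) = -(t ^ 2)⁻¹ *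
      (π ^ 2 / 3 - 8 * π ^ 2 * sigmaExpSum (2 * π * t⁻¹)) - -2 * π / t := by exact_mod_cast h
  have hpi := pi_pos.ne'
  field_simp at h' ⊢
  linear_combination h'

lemma deltaFun_eq {r : ℝ} (hr : 0 < r) :
    deltaFun r = 1 / (2 * r) - π ^ 2 / (12 * r ^ 2) + 2 * sigmaExpSum (2 * r) := by
  have hpi := pi_pos
  have hsum := tsum_inv_sinh_sq_eq_sigmaExpSum (x := π ^ 2 / r) (by positivity)
  have h := sigmaExpSum_transform (t := π / r) (by positivity)
  rw [show 2 * π * (π / r) = 2 * (π ^ 2 / r) by ring,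
    show 2 * π * (π / r)⁻¹ = 2 * r by field_simp] at h
  simp only [deltaFun, mul_div_assoc, hsum]
  field_simp at h ⊢
  linear_combination 2 * h

/-- There is `c < ∞` with `|δ(r) - (1/(2r) - π²/(12r²))| ≤ c e^{-r}` for all `r ≥ 1`. -/
theorem stmt14 : ∃ c : ℝ, ∀ r : ℝ, 1 ≤ r →
    |deltaFun r - (1 / (2 * r) - π ^ 2 / (12 * r ^ 2))| ≤ c * Real.exp (-r) := by
  refine ⟨2 * sigmaExpSum 1, fun r hr ↦ ?_⟩
  rw [deltaFun_eq (one_pos.trans_le hr), add_sub_cancel_left,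
    abs_of_nonneg (mul_nonneg two_pos.le (sigmaExpSum_nonneg _)), mul_assoc]
  exact mul_le_mul_of_nonneg_left (sigmaExpSum_two_mul_le hr) two_pos.le
end

section
/- Define m*(r) = r/6 − 2·∫_0^r δ(s) ds for r > 0 (the integral exists since δ is continuous and bounded on bounded intervals of (0,∞)). Then there exist a constant C > 0 and a constant c < ∞ such that for all r ≥ 2, | r·e^{−r/6}·exp(m*(r)) − C | ≤ c/r. In particular, exp(m*(r)) = C·r^{−1}·e^{r/6}·(1 + O(r^{−1})) as r → ∞. -/
open Real

/-- `m*(r) = r/6 - 2 ∫_0^r δ(s) ds`. -/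
noncomputable def mstar (r : ℝ) : ℝ := r / 6 - 2 * ∫ s in (0:ℝ)..r, deltaFun s

open Filter Topology Set MeasureTheory

/-- The Langevin function `coth t - 1 / t`. -/
noncomputable def langevin (t : ℝ) : ℝ := Real.cosh t / Real.sinh t - 1 / t

/-- The derivative `1 / t² - 1 / sinh² t` of the Langevin function. -/
noncomputable def langevinDeriv (t : ℝ) : ℝ := (t ^ 2)⁻¹ - ((Real.sinh t) ^ 2)⁻¹

/-- A function vanishing at `0` with nonnegative derivative is nonnegative on `[0, ∞)`. -/
lemma nonneg_of_hasDerivAt_nonneg {f f' : ℝ → ℝ} (hf : ∀ t, HasDerivAt f (f' t) t)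
    (h0 : f 0 = 0) (hf' : ∀ t, 0 < t → 0 ≤ f' t) {t : ℝ} (ht : 0 ≤ t) : 0 ≤ f t := by
  have hmono : MonotoneOn f (Ici 0) := by
    refine monotoneOn_of_hasDerivWithinAt_nonneg (convex_Ici 0)
      (fun x _ => (hf x).continuousAt.continuousWithinAt)
      (fun x _ => (hf x).hasDerivWithinAt) ?_
    intro x hx
    rw [interior_Ici] at hx
    exact hf' x hx
  simpa [h0] using hmono self_mem_Ici ht ht

/-- **Lazarević's inequality**. -/
lemma pow_three_mul_cosh_le_sinh_pow_three {t : ℝ} (ht : 0 ≤ t) :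
    t ^ 3 * Real.cosh t ≤ Real.sinh t ^ 3 := by
  have hcube : ∀ s, Real.cosh s * (Real.cosh s ^ (-(1 / 3) : ℝ)) ^ 3 = 1 := fun s => by
    rw [← Real.rpow_natCast, ← Real.rpow_mul (Real.cosh_pos s).le]
    norm_num
    rw [Real.rpow_neg_one, mul_inv_cancel₀ (Real.cosh_pos s).ne']
  have key : 0 ≤ Real.sinh t * Real.cosh t ^ (-(1 / 3) : ℝ) - t := by
    refine nonneg_of_hasDerivAt_nonneg
      (f := fun s => Real.sinh s * Real.cosh s ^ (-(1 / 3) : ℝ) - s)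
      (fun s => (((Real.hasDerivAt_sinh s).mul ((Real.hasDerivAt_cosh s).rpow_const
        (Or.inl (Real.cosh_pos s).ne'))).sub (hasDerivAt_id s))) (by simp) ?_ ht
    intro s _
    have hc := Real.cosh_pos s
    have h4 : Real.cosh s ^ (-(1 / 3) - 1 : ℝ) = (Real.cosh s ^ (-(1 / 3) : ℝ)) ^ 4 := by
      rw [← Real.rpow_natCast (Real.cosh s ^ (-(1 / 3) : ℝ)), ← Real.rpow_mul hc.le]
      norm_num
    have hu : 0 < Real.cosh s ^ (-(1 / 3) : ℝ) := Real.rpow_pos_of_pos hc _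
    have hcu := hcube s
    have hs := Real.sinh_sq s
    rw [h4]
    set u := Real.cosh s ^ (-(1 / 3) : ℝ)
    set c := Real.cosh s
    have hc' : c = 1 / u ^ 3 := by field_simp; exact hcu
    have hrw : c * u + Real.sinh s * (Real.sinh s * -(1 / 3) * u ^ 4) - 1
        = (u ^ 2 - 1) ^ 2 * (u ^ 2 + 2) / (3 * u ^ 2) := by
      rw [show Real.sinh s * (Real.sinh s * -(1 / 3) * u ^ 4)
        = Real.sinh s ^ 2 * (-(1 / 3) * u ^ 4) by ring, hs, hc']
      field_simp
      ring
    rw [hrw]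
    positivity
  have hu : 0 < Real.cosh t ^ (-(1 / 3) : ℝ) := Real.rpow_pos_of_pos (Real.cosh_pos t) _
  have h3 : t ^ 3 ≤ (Real.sinh t * Real.cosh t ^ (-(1 / 3) : ℝ)) ^ 3 :=
    pow_le_pow_left₀ ht (by linarith) 3
  calc t ^ 3 * Real.cosh t
      ≤ (Real.sinh t * Real.cosh t ^ (-(1 / 3) : ℝ)) ^ 3 * Real.cosh t :=
        mul_le_mul_of_nonneg_right h3 (Real.cosh_pos t).le
    _ = Real.sinh t ^ 3 * (Real.cosh t * (Real.cosh t ^ (-(1 / 3) : ℝ)) ^ 3) := by ring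
    _ = Real.sinh t ^ 3 := by rw [hcube, mul_one]

lemma sinh_le_mul_cosh {t : ℝ} (ht : 0 ≤ t) : Real.sinh t ≤ t * Real.cosh t := by
  have := nonneg_of_hasDerivAt_nonneg (f := fun s => s * Real.cosh s - Real.sinh s)
    (fun s => ((hasDerivAt_id s).mul (Real.hasDerivAt_cosh s)).sub (Real.hasDerivAt_sinh s))
    (by simp) (fun s hs => by
      have := mul_pos hs (Real.sinh_pos_iff.2 hs)
      simp only [id]
      linarith) ht
  linarith

lemma mul_cosh_le_one_add_sq_mul_sinh {t : ℝ} (ht : 0 ≤ t) :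
    t * Real.cosh t ≤ (1 + t ^ 2) * Real.sinh t := by
  have := nonneg_of_hasDerivAt_nonneg
    (f := fun s => (1 + s ^ 2) * Real.sinh s - s * Real.cosh s)
    (fun s => ((((hasDerivAt_pow 2 s).const_add 1).mul (Real.hasDerivAt_sinh s)).sub
      ((hasDerivAt_id s).mul (Real.hasDerivAt_cosh s))))
    (by simp) (fun s hs => by
      have h1 := mul_pos hs (Real.sinh_pos_iff.2 hs)
      have h2 := mul_pos (pow_pos hs 2) (Real.cosh_pos s)
      simp only [id]
      norm_num
      nlinarith) ht
  linarith

lemma langevin_nonneg {t : ℝ} (ht : 0 < t) : 0 ≤ langevin t := by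
  have hs := Real.sinh_pos_iff.2 ht
  rw [langevin, sub_nonneg, div_le_div_iff₀ ht hs]
  linarith [sinh_le_mul_cosh ht.le]

lemma langevin_le_self {t : ℝ} (ht : 0 < t) : langevin t ≤ t := by
  have hs := Real.sinh_pos_iff.2 ht
  have h : Real.cosh t / Real.sinh t ≤ (1 + t ^ 2) / t := by
    rw [div_le_div_iff₀ hs ht]
    linarith [mul_cosh_le_one_add_sq_mul_sinh ht.le]
  have h' : (1 + t ^ 2) / t = 1 / t + t := by field_simp
  rw [langevin]
  linarith

lemma langevin_le_one {t : ℝ} (ht : 0 < t) : langevin t ≤ 1 := by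
  have hs := Real.sinh_pos_iff.2 ht
  have h1 := Real.self_le_sinh_iff.2 ht.le
  have h2 : Real.exp (-t) ≤ 1 := Real.exp_le_one_iff.2 (by linarith)
  have h3 := Real.cosh_sub_sinh t
  have h4 : Real.cosh t / Real.sinh t ≤ (t + 1) / t := by
    rw [div_le_div_iff₀ hs ht]
    nlinarith
  have h5 : (t + 1) / t = 1 + 1 / t := by field_simp
  rw [langevin]
  linarith

lemma one_sub_inv_le_langevin {t : ℝ} (ht : 0 < t) : 1 - 1 / t ≤ langevin t := by
  have hs := Real.sinh_pos_iff.2 ht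
  have h : 1 ≤ Real.cosh t / Real.sinh t := by
    rw [one_le_div hs]
    exact (Real.sinh_lt_cosh t).le
  rw [langevin]
  linarith

lemma hasDerivAt_langevin {t : ℝ} (ht : 0 < t) :
    HasDerivAt langevin (langevinDeriv t) t := by
  have hs := Real.sinh_pos_iff.2 ht
  have h := ((Real.hasDerivAt_cosh t).div (Real.hasDerivAt_sinh t) hs.ne').sub
    (hasDerivAt_inv ht.ne')
  have hfun : langevin = fun s => Real.cosh s / Real.sinh s - s⁻¹ := by
    ext s
    rw [langevin, one_div]
  rw [hfun]
  refine h.congr_deriv ?_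
  rw [langevinDeriv]
  have hq := Real.cosh_sq t
  field_simp
  rw [hq]
  ring

lemma langevinDeriv_nonneg {t : ℝ} (ht : 0 < t) : 0 ≤ langevinDeriv t := by
  rw [langevinDeriv, sub_nonneg]
  exact inv_anti₀ (by positivity) (pow_le_pow_left₀ ht.le (Real.self_le_sinh_iff.2 ht.le) 2)

lemma langevinDeriv_antitoneOn : AntitoneOn langevinDeriv (Ioi 0) := by
  have hd : ∀ t ∈ Ioi (0 : ℝ), HasDerivAt langevinDeriv
      (-(2 * t) / (t ^ 2) ^ 2 - -(2 * Real.sinh t * Real.cosh t) / (Real.sinh t ^ 2) ^ 2) t := by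
    intro t ht
    have hs := Real.sinh_pos_iff.2 ht
    have ht' : t ≠ 0 := ne_of_gt ht
    have h := ((hasDerivAt_pow 2 t).fun_inv (by positivity)).fun_sub
      (((Real.hasDerivAt_sinh t).fun_pow 2).fun_inv (by positivity))
    refine h.congr_deriv ?_
    norm_num
  refine antitoneOn_of_hasDerivWithinAt_nonpos (convex_Ioi 0)
    (fun t ht => (hd t ht).continuousAt.continuousWithinAt)
    (fun t ht => (hd t (interior_subset ht)).hasDerivWithinAt) ?_
  intro t ht
  have ht : 0 < t := interior_subset ht
  have hs := Real.sinh_pos_iff.2 ht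
  have h1 : -(2 * t) / (t ^ 2) ^ 2 = -(2 * (1 / t ^ 3)) := by field_simp
  have h2 : -(2 * Real.sinh t * Real.cosh t) / (Real.sinh t ^ 2) ^ 2
      = -(2 * (Real.cosh t / Real.sinh t ^ 3)) := by field_simp
  have h3 : Real.cosh t / Real.sinh t ^ 3 ≤ 1 / t ^ 3 := by
    rw [div_le_div_iff₀ (by positivity) (by positivity)]
    linarith [pow_three_mul_cosh_le_sinh_pow_three ht.le]
  rw [h1, h2]
  linarith

lemma langevin_sub_bounds {a b : ℝ} (ha : 0 < a) (hab : a < b) :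
    (b - a) * langevinDeriv b ≤ langevin b - langevin a ∧
      langevin b - langevin a ≤ (b - a) * langevinDeriv a := by
  obtain ⟨c, ⟨hac, hcb⟩, hc⟩ := exists_hasDerivAt_eq_slope langevin langevinDeriv hab
    (fun t ht => (hasDerivAt_langevin (ha.trans_le ht.1)).continuousAt.continuousWithinAt)
    (fun t ht => hasDerivAt_langevin (ha.trans ht.1))
  have hba : 0 < b - a := sub_pos.2 hab
  have h : langevin b - langevin a = (b - a) * langevinDeriv c := by
    rw [hc]
    field_simp
  have hc0 : 0 < c := ha.trans hac
  rw [h]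
  exact ⟨mul_le_mul_of_nonneg_left (langevinDeriv_antitoneOn hc0 (hc0.trans hcb) hcb.le) hba.le,
    mul_le_mul_of_nonneg_left (langevinDeriv_antitoneOn ha hc0 hac.le) hba.le⟩

lemma mul_langevinDeriv_le_langevin {x : ℝ} (hx : 0 < x) :
    x * langevinDeriv x ≤ langevin x := by
  have hlim : Tendsto (fun ε : ℝ => (x - ε) * langevinDeriv x) (𝓝[>] 0)
      (𝓝 ((x - 0) * langevinDeriv x)) :=
    (Continuous.tendsto (by fun_prop) 0).mono_left nhdsWithin_le_nhds
  rw [sub_zero] at hlim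
  refine le_of_tendsto hlim ?_
  filter_upwards [Ioo_mem_nhdsGT hx] with ε hε
  linarith [(langevin_sub_bounds hε.1 hε.2).1, langevin_nonneg hε.1]

lemma mul_sum_langevinDeriv_le {x : ℝ} (hx : 0 < x) (n : ℕ) :
    x * ∑ k ∈ Finset.range (n + 1), langevinDeriv (((k : ℝ) + 1) * x)
      ≤ langevin (((n : ℝ) + 1) * x) := by
  induction n with
  | zero => simpa using mul_langevinDeriv_le_langevin hx
  | succ n ih =>
    rw [Finset.sum_range_succ, mul_add]
    have h := (langevin_sub_bounds (a := ((n : ℝ) + 1) * x)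
      (b := (((n + 1 : ℕ) : ℝ) + 1) * x) (by positivity) (by push_cast; nlinarith)).1
    have h' : (((n + 1 : ℕ) : ℝ) + 1) * x - ((n : ℝ) + 1) * x = x := by push_cast; ring
    rw [h'] at h
    linarith

lemma langevin_sub_le_mul_sum {x : ℝ} (hx : 0 < x) (n : ℕ) :
    langevin (((n : ℝ) + 1) * x) - langevin x
      ≤ x * ∑ k ∈ Finset.range n, langevinDeriv (((k : ℝ) + 1) * x) := by
  induction n with
  | zero => simp
  | succ n ih =>
    rw [Finset.sum_range_succ, mul_add]
    have h := (langevin_sub_bounds (a := ((n : ℝ) + 1) * x)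
      (b := (((n + 1 : ℕ) : ℝ) + 1) * x) (by positivity) (by push_cast; nlinarith)).2
    have h' : (((n + 1 : ℕ) : ℝ) + 1) * x - ((n : ℝ) + 1) * x = x := by push_cast; ring
    rw [h'] at h
    linarith

lemma hasSum_inv_mul_sq (x : ℝ) :
    HasSum (fun k : ℕ => ((((k : ℝ) + 1) * x) ^ 2)⁻¹) (π ^ 2 / 6 * (x ^ 2)⁻¹) := by
  have h := (hasSum_nat_add_iff' 1).2 hasSum_zeta_two
  simp only [Finset.range_one, Finset.sum_singleton, Nat.cast_zero, Nat.cast_add,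
    Nat.cast_one] at h
  norm_num at h
  simpa [mul_pow, mul_inv, mul_comm] using h.mul_right (x ^ 2)⁻¹

lemma summable_inv_sinh_sq (x : ℝ) :
    Summable (fun k : ℕ => ((Real.sinh (((k : ℝ) + 1) * x)) ^ 2)⁻¹) := by
  rcases eq_or_ne x 0 with rfl | hx
  · simp
  refine Summable.of_nonneg_of_le (fun k => by positivity) (fun k => ?_)
    (hasSum_inv_mul_sq x).summable
  refine inv_anti₀ (by positivity) ?_
  rw [← sq_abs, ← sq_abs (Real.sinh _), Real.abs_sinh]
  exact pow_le_pow_left₀ (abs_nonneg _) (Real.self_le_sinh_iff.2 (abs_nonneg _)) 2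

lemma hasSum_langevinDeriv (x : ℝ) :
    HasSum (fun k : ℕ => langevinDeriv (((k : ℝ) + 1) * x))
      (π ^ 2 / 6 * (x ^ 2)⁻¹ - ∑' k : ℕ, ((Real.sinh (((k : ℝ) + 1) * x)) ^ 2)⁻¹) :=
  (hasSum_inv_mul_sq x).sub (summable_inv_sinh_sq x).hasSum

lemma mul_tsum_langevinDeriv_le_one {x : ℝ} (hx : 0 < x) :
    x * ∑' k : ℕ, langevinDeriv (((k : ℝ) + 1) * x) ≤ 1 := by
  have hlim := ((hasSum_langevinDeriv x).summable.hasSum.tendsto_sum_nat.const_mul x).comp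
    (tendsto_add_atTop_nat 1)
  refine le_of_tendsto' hlim fun n => ?_
  exact (mul_sum_langevinDeriv_le hx n).trans (langevin_le_one (by positivity))

lemma one_sub_le_mul_tsum_langevinDeriv {x : ℝ} (hx : 0 < x) :
    1 - x ≤ x * ∑' k : ℕ, langevinDeriv (((k : ℝ) + 1) * x) := by
  have hlim := (hasSum_langevinDeriv x).summable.hasSum.tendsto_sum_nat.const_mul x
  have hlow : Tendsto (fun n : ℕ => 1 - x⁻¹ * (1 / ((n : ℝ) + 1)) - x) atTop
      (𝓝 (1 - x⁻¹ * 0 - x)) :=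
    ((tendsto_one_div_add_atTop_nhds_zero_nat.const_mul x⁻¹).const_sub 1).sub_const x
  rw [mul_zero, sub_zero] at hlow
  refine le_of_tendsto_of_tendsto' hlow hlim fun n => ?_
  have h1 := one_sub_inv_le_langevin (t := ((n : ℝ) + 1) * x) (by positivity)
  have h2 : 1 / (((n : ℝ) + 1) * x) = x⁻¹ * (1 / ((n : ℝ) + 1)) := by
    field_simp
  linarith [langevin_sub_le_mul_sum hx n, langevin_le_self hx]

lemma deltaFun_eq_tsum_langevinDeriv {r : ℝ} (hr : 0 < r) :
    deltaFun r = π ^ 2 / (2 * r ^ 2) * ∑' k : ℕ, langevinDeriv (((k : ℝ) + 1) * (π ^ 2 / r)) := by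
  have hπ := Real.pi_ne_zero
  rw [(hasSum_langevinDeriv _).tsum_eq, deltaFun, mul_sub]
  simp only [mul_div_assoc]
  congr 1
  field_simp
  norm_num

lemma two_mul_deltaFun_le {r : ℝ} (hr : 0 < r) : 2 * deltaFun r ≤ r⁻¹ := by
  have h := mul_tsum_langevinDeriv_le_one (x := π ^ 2 / r) (by positivity)
  rw [deltaFun_eq_tsum_langevinDeriv hr]
  set S := ∑' k : ℕ, langevinDeriv (((k : ℝ) + 1) * (π ^ 2 / r))
  have h' := mul_le_mul_of_nonneg_left h (inv_pos.2 hr).le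
  have e : 2 * (π ^ 2 / (2 * r ^ 2) * S) = r⁻¹ * (π ^ 2 / r * S) := by field_simp
  linarith

lemma inv_sub_le_two_mul_deltaFun {r : ℝ} (hr : 0 < r) :
    r⁻¹ - π ^ 2 * (r ^ 2)⁻¹ ≤ 2 * deltaFun r := by
  have h := one_sub_le_mul_tsum_langevinDeriv (x := π ^ 2 / r) (by positivity)
  rw [deltaFun_eq_tsum_langevinDeriv hr]
  set S := ∑' k : ℕ, langevinDeriv (((k : ℝ) + 1) * (π ^ 2 / r))
  have h' := mul_le_mul_of_nonneg_left h (inv_pos.2 hr).le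
  have e : 2 * (π ^ 2 / (2 * r ^ 2) * S) = r⁻¹ * (π ^ 2 / r * S) := by field_simp
  have e' : r⁻¹ * (1 - π ^ 2 / r) = r⁻¹ - π ^ 2 * (r ^ 2)⁻¹ := by field_simp
  linarith

lemma deltaFun_nonneg {r : ℝ} (hr : 0 < r) : 0 ≤ deltaFun r := by
  rw [deltaFun_eq_tsum_langevinDeriv hr]
  exact mul_nonneg (by positivity) (tsum_nonneg fun k => langevinDeriv_nonneg (by positivity))

lemma deltaFun_le (r : ℝ) : deltaFun r ≤ 1 / 12 := by
  rw [deltaFun, sub_le_self_iff]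
  exact mul_nonneg (by positivity) (tsum_nonneg fun k => by positivity)

lemma measurable_deltaFun : Measurable deltaFun := by
  have hsum : Measurable fun r : ℝ =>
      ∑' k : ℕ, ((Real.sinh (((k : ℝ) + 1) * π ^ 2 / r)) ^ 2)⁻¹ := by
    refine measurable_of_tendsto_metrizable (f := fun n (r : ℝ) =>
      ∑ k ∈ Finset.range n, ((Real.sinh (((k : ℝ) + 1) * π ^ 2 / r)) ^ 2)⁻¹) (fun n => ?_) ?_
    · refine Finset.measurable_sum _ fun k _ => ?_
      exact ((Real.measurable_sinh.comp (measurable_const.div measurable_id)).pow_const 2).inv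
    · refine tendsto_pi_nhds.2 fun r => ?_
      have h := (summable_inv_sinh_sq (π ^ 2 / r)).hasSum.tendsto_sum_nat
      simpa only [mul_div_assoc] using h
  exact measurable_const.sub ((measurable_const.div
    (measurable_const.mul (measurable_id.pow_const 2))).mul hsum)

lemma intervalIntegrable_deltaFun {a b : ℝ} (ha : 0 ≤ a) (hb : 0 ≤ b) :
    IntervalIntegrable deltaFun volume a b := by
  refine (intervalIntegrable_const (c := (1 / 12 : ℝ))).mono_fun
    measurable_deltaFun.aestronglyMeasurable ?_
  filter_upwards [ae_restrict_mem measurableSet_uIoc] with r hr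
  have hr0 : 0 < r := (le_min ha hb).trans_lt hr.1
  rw [Real.norm_of_nonneg (deltaFun_nonneg hr0), Real.norm_of_nonneg (by norm_num)]
  exact deltaFun_le r

/-- The increments of `log r - 2 ∫₀ʳ δ` lie between `0` and `π² / r`. -/
lemma log_sub_integral_deltaFun_bounds {r s : ℝ} (hr : 0 < r) (hrs : r ≤ s) :
    Real.log r - 2 * (∫ u in (0 : ℝ)..r, deltaFun u)
        ≤ Real.log s - 2 * (∫ u in (0 : ℝ)..s, deltaFun u) ∧
      Real.log s - 2 * (∫ u in (0 : ℝ)..s, deltaFun u)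
        ≤ Real.log r - 2 * (∫ u in (0 : ℝ)..r, deltaFun u) + π ^ 2 / r := by
  have hs : 0 < s := hr.trans_le hrs
  have hadd := intervalIntegral.integral_add_adjacent_intervals
    (intervalIntegrable_deltaFun le_rfl hr.le) (intervalIntegrable_deltaFun hr.le hs.le)
  have h0 : (0 : ℝ) ∉ uIcc r s := by
    rw [uIcc_of_le hrs]
    exact fun h => absurd h.1 (not_le.2 hr)
  have hlog : ∫ u in r..s, u⁻¹ = Real.log s - Real.log r := by
    rw [integral_inv h0, Real.log_div hs.ne' hr.ne']
  have hinv : IntervalIntegrable (fun u : ℝ => u⁻¹) volume r s :=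
    intervalIntegral.intervalIntegrable_inv (fun u hu h => h0 (h ▸ hu)) continuousOn_id
  have hcont : ContinuousOn (fun u : ℝ => π ^ 2 * (u ^ 2)⁻¹) (uIcc r s) :=
    continuousOn_const.mul ((continuousOn_id.pow 2).inv₀ fun u hu h =>
      h0 ((pow_eq_zero_iff two_ne_zero).1 h ▸ hu))
  have hsq : ∫ u in r..s, π ^ 2 * (u ^ 2)⁻¹ = π ^ 2 / r - π ^ 2 / s := by
    have hd : ∀ u ∈ uIcc r s, HasDerivAt (fun v : ℝ => -(π ^ 2 * v⁻¹)) (π ^ 2 * (u ^ 2)⁻¹) u := by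
      intro u hu
      have hu0 : u ≠ 0 := fun h => h0 (h ▸ hu)
      exact (((hasDerivAt_inv hu0).const_mul (π ^ 2)).fun_neg).congr_deriv (by ring)
    rw [intervalIntegral.integral_eq_sub_of_hasDerivAt hd hcont.intervalIntegrable]
    ring
  have hδ := (intervalIntegrable_deltaFun hr.le hs.le).const_mul 2
  have hupper : ∫ u in r..s, 2 * deltaFun u ≤ ∫ u in r..s, u⁻¹ :=
    intervalIntegral.integral_mono_on hrs hδ hinv
      fun u hu => two_mul_deltaFun_le (hr.trans_le hu.1)
  have hlower : ∫ u in r..s, (u⁻¹ - π ^ 2 * (u ^ 2)⁻¹) ≤ ∫ u in r..s, 2 * deltaFun u :=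
    intervalIntegral.integral_mono_on hrs (hinv.sub hcont.intervalIntegrable) hδ
      fun u hu => inv_sub_le_two_mul_deltaFun (hr.trans_le hu.1)
  rw [intervalIntegral.integral_sub hinv hcont.intervalIntegrable, hlog, hsq] at hlower
  rw [hlog] at hupper
  rw [intervalIntegral.integral_const_mul] at hlower hupper
  have hpos : 0 ≤ π ^ 2 / s := by positivity
  constructor <;> linarith

/-- There exist `C > 0` and `c < ∞` such that for all `r ≥ 2`,
`|r e^{-r/6} exp(m*(r)) - C| ≤ c/r`; i.e. `exp(m*(r)) = C r⁻¹ e^{r/6}(1 + O(1/r))`. -/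
theorem stmt15 : ∃ C : ℝ, 0 < C ∧ ∃ c : ℝ, ∀ r : ℝ, 2 ≤ r →
    |r * Real.exp (-r / 6) * Real.exp (mstar r) - C| ≤ c / r := by
  set φ : ℝ → ℝ := fun r => Real.log r - 2 * (∫ u in (0 : ℝ)..r, deltaFun u)
  have hbound : ∀ r : ℝ, 2 ≤ r → ∀ s ∈ φ '' Ici 2, s ≤ φ r + π ^ 2 / r := by
    rintro r hr _ ⟨s, hs, rfl⟩
    have hr0 : 0 < r := by linarith
    rcases le_total r s with h | h
    · exact (log_sub_integral_deltaFun_bounds hr0 h).2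
    · have h1 := (log_sub_integral_deltaFun_bounds (two_pos.trans_le hs) h).1
      have h2 : 0 ≤ π ^ 2 / r := by positivity
      exact h1.trans (le_add_of_nonneg_right h2)
  have hne : (φ '' Ici 2).Nonempty := ⟨φ 2, 2, self_mem_Ici, rfl⟩
  have hbdd : BddAbove (φ '' Ici 2) := ⟨_, hbound 2 le_rfl⟩
  set L := sSup (φ '' Ici 2)
  refine ⟨Real.exp L, Real.exp_pos L, Real.exp L * π ^ 2, fun r hr => ?_⟩
  have hr0 : 0 < r := by linarith
  have h1 : φ r ≤ L := le_csSup hbdd ⟨r, hr, rfl⟩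
  have h2 : L ≤ φ r + π ^ 2 / r := csSup_le hne (hbound r hr)
  have heq : r * Real.exp (-r / 6) * Real.exp (mstar r) = Real.exp (φ r) := by
    rw [mul_assoc, ← Real.exp_add, mstar,
      show φ r = Real.log r + -(2 * ∫ u in (0 : ℝ)..r, deltaFun u) from sub_eq_add_neg _ _,
      Real.exp_add (Real.log r), Real.exp_log hr0]
    ring_nf
  rw [heq, abs_sub_comm, abs_of_nonneg (sub_nonneg.2 (Real.exp_le_exp.2 h1))]
  have h3 := Real.add_one_le_exp (φ r - L)
  have h4 : Real.exp (φ r) = Real.exp L * Real.exp (φ r - L) := by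
    rw [← Real.exp_add, add_sub_cancel]
  have h5 : Real.exp L * (1 - π ^ 2 / r) ≤ Real.exp L * Real.exp (φ r - L) :=
    mul_le_mul_of_nonneg_left (by linarith) (Real.exp_pos L).le
  rw [h4]
  calc Real.exp L - Real.exp L * Real.exp (φ r - L) ≤ Real.exp L * (π ^ 2 / r) := by linarith
    _ = Real.exp L * π ^ 2 / r := by ring
end

section
/- For every r > 0 and x ∈ ℝ, the function J is differentiable in r and twice differentiable in x, and the function Φ(r,x) = r·J(r,x) satisfies the partial differential equation ∂_r Φ(r,x) = ∂²_x Φ(r,x) + H_I(r,x)·∂_x Φ(r,x) + (∂_x H_I(r,x))·Φ(r,x), where ∂_x H_I(r,x) = J(r,x) − 1/r. -/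
open Real

open Filter Topology

/-- The lattice sum `∑_{k ∈ ℤ} g (a (x + 2kπ))`. -/
noncomputable def latticeSum (g : ℝ → ℝ) (a x : ℝ) : ℝ :=
  ∑' k : ℤ, g (a * (x + 2 * (k : ℝ) * π))

/-- Quadratic decay at infinity. -/
def QuadDecay (g : ℝ → ℝ) : Prop := ∃ C, ∀ u, |g u| ≤ C / (1 + u ^ 2)

lemma QuadDecay.exists_nonneg {g : ℝ → ℝ} (hg : QuadDecay g) :
    ∃ C, 0 ≤ C ∧ ∀ u, |g u| ≤ C / (1 + u ^ 2) := by
  obtain ⟨C, hC⟩ := hg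
  refine ⟨C, ?_, hC⟩
  have := (abs_nonneg _).trans (hC 0)
  simpa using this

lemma summable_one_div_one_add_int_sq : Summable fun k : ℤ => 1 / (1 + (k : ℝ) ^ 2) := by
  refine Summable.of_norm_bounded_eventually
    (Real.summable_one_div_int_pow.mpr (one_lt_two : 1 < 2)) ?_
  filter_upwards [(Set.finite_singleton (0 : ℤ)).compl_mem_cofinite] with k hk
  have hk0 : (k : ℝ) ≠ 0 := by simpa using hk
  have : 0 < (k : ℝ) ^ 2 := by positivity
  rw [Real.norm_of_nonneg (by positivity)]
  gcongr
  linarith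

lemma one_add_int_sq_le {a₀ a R x : ℝ} (ha₀ : 0 < a₀) (ha : a₀ ≤ a) (hx : |x| ≤ R) (k : ℤ) :
    1 + (k : ℝ) ^ 2 ≤
      (1 + R ^ 2 + 1 / a₀ ^ 2) * (1 + (a * (x + 2 * (k : ℝ) * π)) ^ 2) := by
  set y := x + 2 * (k : ℝ) * π with hy
  have hx2 : x ^ 2 ≤ R ^ 2 := sq_le_sq' (abs_le.mp hx).1 (abs_le.mp hx).2
  have hk : (k : ℝ) ^ 2 ≤ y ^ 2 + x ^ 2 := by
    have h1 : (2 * (k : ℝ) * π) ^ 2 ≤ 2 * y ^ 2 + 2 * x ^ 2 := by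
      have : 2 * (k : ℝ) * π = y - x := by rw [hy]; ring
      rw [this]
      nlinarith [sq_nonneg (y + x)]
    have h2 : (1 : ℝ) ≤ π ^ 2 := by nlinarith [Real.pi_gt_three]
    nlinarith [mul_le_mul_of_nonneg_left h2 (sq_nonneg (k : ℝ))]
  have hya : y ^ 2 ≤ 1 / a₀ ^ 2 * (a * y) ^ 2 := by
    rw [one_div, ← div_eq_inv_mul, le_div_iff₀ (by positivity), mul_pow, mul_comm]
    gcongr
  have hR : 0 ≤ R ^ 2 * (a * y) ^ 2 := by positivity
  have hA : 0 ≤ 1 / a₀ ^ 2 := by positivity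
  have hB : 0 ≤ (a * y) ^ 2 := by positivity
  nlinarith

/-- A quadratically decaying function is dominated on the lattice, locally uniformly in the
scale and in the offset. -/
lemma QuadDecay.exists_bound {g : ℝ → ℝ} (hg : QuadDecay g) {a₀ : ℝ} (ha₀ : 0 < a₀) (R : ℝ) :
    ∃ K, 0 ≤ K ∧ ∀ a x, a₀ ≤ a → |x| ≤ R → ∀ k : ℤ,
      |g (a * (x + 2 * (k : ℝ) * π))| ≤ K * (1 / (1 + (k : ℝ) ^ 2)) := by
  obtain ⟨C, hC0, hC⟩ := hg.exists_nonneg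
  refine ⟨C * (1 + R ^ 2 + 1 / a₀ ^ 2), by positivity, fun a x ha hx k => (hC _).trans ?_⟩
  rw [mul_one_div, div_le_div_iff₀ (by positivity) (by positivity), mul_assoc]
  exact mul_le_mul_of_nonneg_left (one_add_int_sq_le ha₀ ha hx k) hC0

lemma QuadDecay.summable {g : ℝ → ℝ} (hg : QuadDecay g) {a : ℝ} (ha : 0 < a) (x : ℝ) :
    Summable fun k : ℤ => g (a * (x + 2 * (k : ℝ) * π)) := by
  obtain ⟨K, -, hK⟩ := hg.exists_bound ha |x|
  exact Summable.of_norm_bounded (summable_one_div_one_add_int_sq.mul_left K)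
    fun k => hK a x le_rfl le_rfl k

section Derivatives

variable {g g' : ℝ → ℝ} {a : ℝ}

lemma summable_and_hasDerivAt_tsum_sub (hg : ∀ u, HasDerivAt g (g' u) u) (hg' : QuadDecay g')
    (ha : 0 < a) (c : ℤ → ℝ) (x₀ : ℝ)
    (hs : Summable fun k : ℤ => g (a * (x₀ + 2 * (k : ℝ) * π)) - c k) (x : ℝ) :
    (Summable fun k : ℤ => g (a * (x + 2 * (k : ℝ) * π)) - c k) ∧
    HasDerivAt (fun y => ∑' k : ℤ, (g (a * (y + 2 * (k : ℝ) * π)) - c k))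
      (a * latticeSum g' a x) x := by
  set R := |x| + |x₀| + 1
  obtain ⟨K, -, hK⟩ := hg'.exists_bound ha R
  have hsum : Summable fun k : ℤ => a * (K * (1 / (1 + (k : ℝ) ^ 2))) :=
    (summable_one_div_one_add_int_sq.mul_left K).mul_left a
  have hmem : ∀ y, |y| < R → y ∈ Metric.ball (0 : ℝ) R := fun y hy => by simpa using hy
  have hx : x ∈ Metric.ball (0 : ℝ) R := hmem x (by linarith [abs_nonneg x₀])
  have hx₀ : x₀ ∈ Metric.ball (0 : ℝ) R := hmem x₀ (by linarith [abs_nonneg x])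
  have hder : ∀ (k : ℤ) (y : ℝ), y ∈ Metric.ball (0 : ℝ) R →
      HasDerivAt (fun y => g (a * (y + 2 * (k : ℝ) * π)) - c k)
        (a * g' (a * (y + 2 * (k : ℝ) * π))) y := fun k y _ => by
    have h : HasDerivAt (fun y => a * (y + 2 * (k : ℝ) * π)) a y := by
      simpa using ((hasDerivAt_id y).add_const (2 * (k : ℝ) * π)).const_mul a
    rw [mul_comm a (g' _)]
    exact ((hg _).comp y h).sub_const (c k)
  have hbd : ∀ (k : ℤ) (y : ℝ), y ∈ Metric.ball (0 : ℝ) R →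
      ‖a * g' (a * (y + 2 * (k : ℝ) * π))‖ ≤ a * (K * (1 / (1 + (k : ℝ) ^ 2))) :=
    fun k y hy => by
    have hy' : |y| < R := by simpa using hy
    rw [norm_mul, Real.norm_of_nonneg ha.le]
    exact mul_le_mul_of_nonneg_left (hK a y le_rfl hy'.le k) ha.le
  have hpre : IsPreconnected (Metric.ball (0 : ℝ) R) := (convex_ball 0 R).isPreconnected
  refine ⟨summable_of_summable_hasDerivAt_of_isPreconnected hsum Metric.isOpen_ball hpre hder hbd
    hx₀ hs hx, ?_⟩
  rw [latticeSum, ← tsum_mul_left]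
  exact hasDerivAt_tsum_of_isPreconnected hsum Metric.isOpen_ball hpre hder hbd hx₀ hs hx

lemma hasDerivAt_latticeSum (hg : ∀ u, HasDerivAt g (g' u) u) (hgd : QuadDecay g)
    (hg' : QuadDecay g') (ha : 0 < a) (x : ℝ) :
    HasDerivAt (latticeSum g a) (a * latticeSum g' a x) x := by
  have hs : Summable fun k : ℤ => g (a * (x + 2 * (k : ℝ) * π)) - 0 := by
    simpa using hgd.summable ha x
  have h := (summable_and_hasDerivAt_tsum_sub hg hg' ha (fun _ => 0) x hs x).2
  simp only [sub_zero] at h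
  exact h

lemma hasDerivAt_latticeSum_scale (hg : ∀ u, HasDerivAt g (g' u) u) (hgd : QuadDecay g)
    (hg' : QuadDecay fun u => u * g' u) (ha : 0 < a) (x : ℝ) :
    HasDerivAt (fun b => latticeSum g b x) (latticeSum (fun u => u * g' u) a x / a) a := by
  have ha2 : 0 < a / 2 := half_pos ha
  obtain ⟨K, hK0, hK⟩ := hg'.exists_bound ha2 |x|
  have hsum : Summable fun k : ℤ => (K * (1 / (1 + (k : ℝ) ^ 2))) / (a / 2) :=
    (summable_one_div_one_add_int_sq.mul_left K).div_const _
  have hmem : a ∈ Set.Ioi (a / 2) := half_lt_self ha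
  rw [latticeSum, ← tsum_div_const]
  refine hasDerivAt_tsum_of_isPreconnected
    (g' := fun (k : ℤ) b => b * (x + 2 * (k : ℝ) * π) * g' (b * (x + 2 * (k : ℝ) * π)) / b)
    hsum isOpen_Ioi isPreconnected_Ioi
    (fun k b hb => ?_) (fun k b hb => ?_) hmem (hgd.summable ha x) hmem
  · have hb0 : b ≠ 0 := (ha2.trans hb).ne'
    have h : HasDerivAt (fun b => b * (x + 2 * (k : ℝ) * π)) (x + 2 * (k : ℝ) * π) b := by
      simpa using (hasDerivAt_id b).mul_const (x + 2 * (k : ℝ) * π)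
    rw [mul_assoc b, mul_div_cancel_left₀ _ hb0, mul_comm _ (g' _)]
    exact (hg _).comp b h
  · have hb0 : 0 < b := ha2.trans hb
    rw [norm_div, Real.norm_of_nonneg hb0.le]
    exact div_le_div₀ (by positivity) (hK b x (le_of_lt hb) le_rfl k) ha2 (le_of_lt hb)

end Derivatives

/-- The square of the hyperbolic secant. -/
noncomputable def sechSq (u : ℝ) : ℝ := (Real.cosh u ^ 2)⁻¹

lemma sechSq_nonneg (u : ℝ) : 0 ≤ sechSq u := by unfold sechSq; positivity

lemma sechSq_le_one (u : ℝ) : sechSq u ≤ 1 :=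
  inv_le_one_of_one_le₀ (one_le_pow₀ (Real.one_le_cosh u))

lemma sechSq_eq_one_sub_tanh_sq (u : ℝ) : sechSq u = 1 - Real.tanh u ^ 2 := by
  have h := (Real.cosh_pos u).ne'
  rw [sechSq, Real.tanh_eq_sinh_div_cosh]
  field_simp
  linarith [Real.cosh_sq u]

lemma hasDerivAt_tanh (u : ℝ) : HasDerivAt Real.tanh (sechSq u) u := by
  have h := (Real.cosh_pos u).ne'
  have := (Real.hasDerivAt_sinh u).div (Real.hasDerivAt_cosh u) h
  have he : Real.tanh = Real.sinh / Real.cosh := by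
    ext v; simp [Real.tanh_eq_sinh_div_cosh]
  rw [he]
  convert! this using 1
  rw [sechSq]
  field_simp
  linarith [Real.cosh_sq u]

/-- The derivative of `sechSq`. -/
noncomputable def sechSqDeriv (u : ℝ) : ℝ := -2 * (Real.tanh u * sechSq u)

/-- The second derivative of `sechSq`. -/
noncomputable def sechSqDeriv₂ (u : ℝ) : ℝ :=
  -2 * (sechSq u * sechSq u + Real.tanh u * sechSqDeriv u)

lemma hasDerivAt_sechSq (u : ℝ) : HasDerivAt sechSq (sechSqDeriv u) u := by
  have he : sechSq = fun v => 1 - Real.tanh v ^ 2 := funext sechSq_eq_one_sub_tanh_sq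
  rw [he]
  convert! ((hasDerivAt_tanh u).pow 2).const_sub 1 using 1
  rw [show sechSqDeriv u = -2 * (Real.tanh u * sechSq u) from rfl]
  push_cast
  ring

lemma hasDerivAt_sechSqDeriv (u : ℝ) : HasDerivAt sechSqDeriv (sechSqDeriv₂ u) u :=
  ((hasDerivAt_tanh u).mul (hasDerivAt_sechSq u)).const_mul (-2)

lemma hasDerivAt_id_mul_sechSq (u : ℝ) :
    HasDerivAt (fun v => v * sechSq v) (sechSq u + u * sechSqDeriv u) u := by
  have h := (hasDerivAt_id' u).mul (hasDerivAt_sechSq u)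
  rw [one_mul] at h
  exact h

lemma one_add_sq_div_two_le_cosh (u : ℝ) : 1 + u ^ 2 / 2 ≤ Real.cosh u := by
  have h1 : Real.cosh u = 1 + 2 * Real.sinh (u / 2) ^ 2 := by
    have h := Real.cosh_two_mul (u / 2)
    rw [mul_div_cancel₀ _ two_ne_zero] at h
    rw [h, Real.cosh_sq]
    ring
  have h2 : (u / 2) ^ 2 ≤ Real.sinh (u / 2) ^ 2 := by
    rcases le_total 0 (u / 2) with h | h
    · exact pow_le_pow_left₀ h (Real.self_le_sinh_iff.mpr h) 2
    · have := Real.sinh_le_self_iff.mpr h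
      nlinarith
  rw [h1]
  linarith

lemma one_add_abs_mul_sechSq_le (u : ℝ) : (1 + |u|) * sechSq u ≤ 4 / (1 + u ^ 2) := by
  have h1 : (1 + u ^ 2 / 2) ^ 2 ≤ Real.cosh u ^ 2 :=
    pow_le_pow_left₀ (by positivity) (one_add_sq_div_two_le_cosh u) 2
  have hc : 0 < Real.cosh u ^ 2 := by have := Real.cosh_pos u; positivity
  rw [sechSq, ← div_eq_mul_inv, div_le_div_iff₀ hc (by positivity)]
  have h2 : |u| ≤ (1 + u ^ 2) / 2 := by nlinarith [sq_nonneg (|u| - 1), sq_abs u]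
  nlinarith [mul_le_mul_of_nonneg_right h2 (by positivity : 0 ≤ 1 + u ^ 2), sq_nonneg (u ^ 2)]

lemma quadDecay_of_le {g : ℝ → ℝ} (C : ℝ) (h : ∀ u, |g u| ≤ C * ((1 + |u|) * sechSq u))
    (hC : 0 ≤ C) : QuadDecay g :=
  ⟨C * 4, fun u => (h u).trans (by
    rw [mul_div_assoc]
    exact mul_le_mul_of_nonneg_left (one_add_abs_mul_sechSq_le u) hC)⟩

lemma abs_sechSqDeriv_le (u : ℝ) : |sechSqDeriv u| ≤ 2 * sechSq u := by
  rw [sechSqDeriv, abs_mul, abs_mul, abs_of_nonneg (sechSq_nonneg u)]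
  have := mul_le_mul_of_nonneg_right (Real.abs_tanh_lt_one u).le (sechSq_nonneg u)
  norm_num
  linarith

lemma quadDecay_sechSq : QuadDecay sechSq :=
  quadDecay_of_le 1 (fun u => by
    rw [abs_of_nonneg (sechSq_nonneg u)]
    nlinarith [mul_nonneg (abs_nonneg u) (sechSq_nonneg u)]) zero_le_one

lemma quadDecay_sechSqDeriv : QuadDecay sechSqDeriv :=
  quadDecay_of_le 2 (fun u => by
    nlinarith [abs_sechSqDeriv_le u, mul_nonneg (abs_nonneg u) (sechSq_nonneg u)]) zero_le_two

lemma quadDecay_sechSqDeriv₂ : QuadDecay sechSqDeriv₂ :=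
  quadDecay_of_le 6 (fun u => by
    have h0 := sechSq_nonneg u
    have h1 : |sechSq u * sechSq u| ≤ sechSq u := by
      rw [abs_mul, abs_of_nonneg h0]
      exact mul_le_of_le_one_left h0 (sechSq_le_one u)
    have h2 : |Real.tanh u * sechSqDeriv u| ≤ 2 * sechSq u := by
      rw [abs_mul]
      exact (mul_le_of_le_one_left (abs_nonneg _) (Real.abs_tanh_lt_one u).le).trans
        (abs_sechSqDeriv_le u)
    have h3 := abs_add_le (sechSq u * sechSq u) (Real.tanh u * sechSqDeriv u)
    rw [sechSqDeriv₂, abs_mul]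
    norm_num
    nlinarith [mul_nonneg (abs_nonneg u) h0]) (by norm_num)

lemma quadDecay_id_mul_sechSq : QuadDecay fun u => u * sechSq u :=
  quadDecay_of_le 1 (fun u => by
    rw [abs_mul, abs_of_nonneg (sechSq_nonneg u)]
    nlinarith [sechSq_nonneg u]) zero_le_one

lemma quadDecay_id_mul_sechSqDeriv : QuadDecay fun u => u * sechSqDeriv u :=
  quadDecay_of_le 2 (fun u => by
    rw [abs_mul]
    nlinarith [sechSq_nonneg u, mul_le_mul_of_nonneg_left (abs_sechSqDeriv_le u) (abs_nonneg u)])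
    zero_le_two

lemma QuadDecay.add {g h : ℝ → ℝ} (hg : QuadDecay g) (hh : QuadDecay h) :
    QuadDecay fun u => g u + h u := by
  obtain ⟨C, hC⟩ := hg
  obtain ⟨D, hD⟩ := hh
  exact ⟨C + D, fun u => (abs_add_le _ _).trans (by rw [add_div]; exact add_le_add (hC u) (hD u))⟩

/-- The hyperbolic cotangent (with value `0` at `0`). -/
noncomputable def coth (w : ℝ) : ℝ := Real.cosh w / Real.sinh w

lemma coth_neg (w : ℝ) : coth (-w) = -coth w := by simp [coth, div_neg]

lemma sechSq_mul_tanh_add {u v : ℝ} (h : u ≠ v) :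
    sechSq u * Real.tanh v + sechSq v * Real.tanh u = coth (v - u) * (sechSq u - sechSq v) := by
  have hs : Real.sinh (v - u) ≠ 0 := by simpa [sub_eq_zero] using h.symm
  have hu := (Real.cosh_pos u).ne'
  have hv := (Real.cosh_pos v).ne'
  rw [coth, div_mul_eq_mul_div, eq_div_iff hs]
  simp only [sechSq, Real.tanh_eq_sinh_div_cosh]
  field_simp
  rw [Real.sinh_sub, Real.cosh_sub]
  linear_combination Real.cosh u * Real.cosh v * (Real.cosh_sq u - Real.cosh_sq v)

lemma abs_coth_sub_one_le {w : ℝ} (hw : 0 < w) : |coth w - 1| ≤ 1 / w := by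
  have hs : w ≤ Real.sinh w := Real.self_le_sinh_iff.mpr hw.le
  have hs0 : 0 < Real.sinh w := hw.trans_le hs
  have : coth w - 1 = Real.exp (-w) / Real.sinh w := by
    rw [coth, ← Real.cosh_sub_sinh]
    field_simp
  rw [this, abs_of_nonneg (by positivity)]
  exact div_le_div₀ zero_le_one (Real.exp_le_one_iff.mpr (by linarith)) hw hs

lemma abs_coth_mul_int_le {b : ℝ} (hb : 0 < b) (m : ℤ) : |coth (b * m)| ≤ 1 + 1 / b := by
  have key : ∀ n : ℤ, 0 < n → |coth (b * n)| ≤ 1 + 1 / b := fun n hn => by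
    have hn1 : (1 : ℝ) ≤ n := by exact_mod_cast hn
    have hbn : b ≤ b * n := le_mul_of_one_le_right hb.le hn1
    have h1 := abs_coth_sub_one_le (hb.trans_le hbn)
    have h2 : 1 / (b * n) ≤ 1 / b := one_div_le_one_div_of_le hb hbn
    have h3 := abs_add_le (coth (b * n) - 1) 1
    rw [sub_add_cancel, abs_one] at h3
    linarith
  rcases lt_trichotomy m 0 with hm | rfl | hm
  · have := key (-m) (by omega)
    rwa [Int.cast_neg, mul_neg, coth_neg, abs_neg] at this
  · simp only [coth, Int.cast_zero, mul_zero, Real.sinh_zero, div_zero, abs_zero]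
    positivity
  · exact key m hm

lemma tendsto_coth_atTop : Tendsto coth atTop (𝓝 1) := by
  rw [tendsto_iff_norm_sub_tendsto_zero]
  refine squeeze_zero' (Eventually.of_forall fun _ => norm_nonneg _) ?_
    (tendsto_const_nhds.div_atTop tendsto_id : Tendsto (fun w : ℝ => 1 / w) atTop (𝓝 0))
  filter_upwards [eventually_gt_atTop 0] with w hw using abs_coth_sub_one_le hw

lemma tendsto_coth_atBot : Tendsto coth atBot (𝓝 (-1)) := by
  have := (tendsto_coth_atTop.comp tendsto_neg_atBot_atTop).neg
  refine this.congr fun w => ?_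
  simp [coth_neg]

lemma sum_Icc_neg_eq_zero {F : ℤ → ℝ} (hF : ∀ j, F (-j) = -F j) (N : ℕ) :
    ∑ j ∈ Finset.Icc (-N : ℤ) N, F j = 0 := by
  have h := Finset.sum_equiv (s := Finset.Icc (-N : ℤ) N) (t := Finset.Icc (-N : ℤ) N)
    (f := F) (g := fun j => -F j) (Equiv.neg ℤ)
    (fun j => by simp only [Finset.mem_Icc, Equiv.neg_apply]; omega)
    (fun j _ => by simp [hF])
  rw [Finset.sum_neg_distrib] at h
  linarith

lemma sum_Icc_neg_sub_eq (F : ℤ → ℝ) (N : ℕ) :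
    ∑ j ∈ Finset.Icc (-N : ℤ) N, (F (j - 1) - F j) = F (-N - 1) - F N := by
  induction N with
  | zero => simp
  | succ n ih =>
    push_cast
    rw [Finset.sum_Icc_succ_eq_add_endpoints, ih]
    rw [show ((n : ℤ) + 1 - 1) = n by ring, show (-((n : ℤ) + 1)) = -n - 1 by ring]
    ring

/-- The sum of `coth` over a symmetric window of a lattice, centred at the `k`-th point. -/
noncomputable def cothSum (b : ℝ) (N : ℕ) (k : ℤ) : ℝ :=
  ∑ j ∈ Finset.Icc (-N : ℤ) N, coth (b * ((j - k : ℤ) : ℝ))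

lemma cothSum_zero (b : ℝ) (N : ℕ) : cothSum b N 0 = 0 :=
  sum_Icc_neg_eq_zero (fun j => by
    simp only [sub_zero, Int.cast_neg, mul_neg, coth_neg]) N

lemma cothSum_succ (b : ℝ) (N : ℕ) (k : ℤ) :
    cothSum b N (k + 1) = cothSum b N k +
      (coth (b * ((-N - 1 - k : ℤ) : ℝ)) - coth (b * ((N - k : ℤ) : ℝ))) := by
  rw [← sum_Icc_neg_sub_eq (fun j : ℤ => coth (b * ((j - k : ℤ) : ℝ))) N,
    Finset.sum_sub_distrib, cothSum, cothSum]
  simp only [sub_sub, add_comm k 1]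
  ring

lemma abs_cothSum_le {b : ℝ} (hb : 0 < b) (N : ℕ) (k : ℤ) :
    |cothSum b N k| ≤ 2 * (1 + 1 / b) * |(k : ℝ)| := by
  have hstep : ∀ i : ℤ, |cothSum b N (i + 1) - cothSum b N i| ≤ 2 * (1 + 1 / b) := fun i => by
    rw [cothSum_succ, add_sub_cancel_left]
    refine (abs_sub _ _).trans ?_
    linarith [abs_coth_mul_int_le hb (-N - 1 - i), abs_coth_mul_int_le hb (N - i)]
  induction k using Int.induction_on with
  | zero => simp [cothSum_zero]
  | succ i ih =>
    have h := abs_add_le (cothSum b N (i + 1) - cothSum b N i) (cothSum b N i)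
    rw [sub_add_cancel] at h
    have h' := hstep i
    push_cast at ih ⊢
    rw [abs_of_nonneg (i.cast_nonneg : (0 : ℝ) ≤ i)] at ih
    rw [abs_of_nonneg (by positivity : (0 : ℝ) ≤ i + 1)]
    linarith
  | pred i ih =>
    have h := abs_sub (cothSum b N (-i)) (cothSum b N (-i) - cothSum b N (-i - 1))
    rw [sub_sub_cancel] at h
    have h' := hstep (-i - 1)
    rw [sub_add_cancel] at h'
    push_cast at ih ⊢
    rw [abs_neg (i : ℝ), abs_of_nonneg (i.cast_nonneg : (0 : ℝ) ≤ i)] at ih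
    rw [show -(i : ℝ) - 1 = -(i + 1) by ring, abs_neg (i + 1 : ℝ),
      abs_of_nonneg (by positivity : (0 : ℝ) ≤ i + 1)]
    linarith

lemma tendsto_cothSum {b : ℝ} (hb : 0 < b) (k : ℤ) :
    Tendsto (fun N : ℕ => cothSum b N k) atTop (𝓝 (-2 * (k : ℝ))) := by
  have hN : Tendsto (fun N : ℕ => (N : ℝ)) atTop atTop := tendsto_natCast_atTop_atTop
  have hstep : ∀ i : ℤ, Tendsto (fun N : ℕ =>
      coth (b * ((-N - 1 - i : ℤ) : ℝ)) - coth (b * ((N - i : ℤ) : ℝ))) atTop (𝓝 (-2)) := by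
    intro i
    have h1 : Tendsto (fun N : ℕ => b * ((N - i : ℤ) : ℝ)) atTop atTop := by
      push_cast
      exact (tendsto_atTop_add_const_right atTop (-(i : ℝ)) hN).const_mul_atTop hb
    have h2 : Tendsto (fun N : ℕ => b * ((-N - 1 - i : ℤ) : ℝ)) atTop atBot := by
      have := (tendsto_atTop_add_const_right atTop (1 + (i : ℝ)) hN).const_mul_atTop hb
      refine (tendsto_neg_atTop_atBot.comp this).congr fun N => ?_
      simp only [Function.comp_apply]
      push_cast
      ring
    have := (tendsto_coth_atBot.comp h2).sub (tendsto_coth_atTop.comp h1)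
    rwa [show (-1 - 1 : ℝ) = -2 by norm_num] at this
  induction k using Int.induction_on with
  | zero => simp [cothSum_zero]
  | succ i ih =>
    have := ih.add (hstep i)
    convert! this using 2
    · exact cothSum_succ _ _ _
    · push_cast; ring
  | pred i ih =>
    have := ih.sub (hstep (-i - 1))
    convert! this using 2 with N
    · have := cothSum_succ b N (-i - 1)
      rw [sub_add_cancel] at this
      linarith
    · push_cast; ring

lemma sum_mul_sum_eq_of_antisymm {ι : Type*} [DecidableEq ι] (s : Finset ι) (T D : ι → ℝ)
    (c : ι → ι → ℝ) (hc : ∀ j k, c k j = -c j k)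
    (h : ∀ j k, j ≠ k → D k * T j + D j * T k = c j k * (D k - D j)) :
    (∑ j ∈ s, T j) * ∑ k ∈ s, D k = ∑ k ∈ s, T k * D k + ∑ k ∈ s, D k * ∑ j ∈ s, c j k := by
  have hswap : ∀ F : ι → ι → ℝ, ∑ k ∈ s, ∑ j ∈ s, F k j = ∑ k ∈ s, ∑ j ∈ s, F j k :=
    fun F => Finset.sum_comm
  have h0 : (∑ j ∈ s, T j) * ∑ k ∈ s, D k = ∑ k ∈ s, ∑ j ∈ s, D k * T j := by
    rw [mul_comm, Finset.sum_mul_sum]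
  have h1 : ∑ k ∈ s, D k * ∑ j ∈ s, c j k = ∑ k ∈ s, ∑ j ∈ s, D k * c j k := by
    simp only [Finset.mul_sum]
  have h2 : ∑ k ∈ s, T k * D k = ∑ k ∈ s, ∑ j ∈ s, if k = j then T k * D k else 0 := by
    refine Finset.sum_congr rfl fun k hk => ?_
    rw [Finset.sum_ite_eq, if_pos hk]
  have h3 : ∑ k ∈ s, ∑ j ∈ s, (D k * T j + D j * T k) =
      ∑ k ∈ s, ∑ j ∈ s, ((if k = j then T k * D k else 0) +
        (if k = j then T k * D k else 0) + D k * c j k + D j * c k j) := by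
    refine Finset.sum_congr rfl fun k _ => Finset.sum_congr rfl fun j _ => ?_
    rcases eq_or_ne k j with rfl | hkj
    · have := hc k k
      simp only [if_true]
      linear_combination (-2 * D k) * (by linarith : c k k = 0)
    · rw [h j k hkj.symm, if_neg hkj, hc j k]
      ring
  simp only [Finset.sum_add_distrib] at h3
  have h4 := hswap fun k j => D k * T j
  have h5 := hswap fun k j => D k * c j k
  rw [h0, h1, h2]
  linarith

/-- The primitive of `a * latticeSum sechSq a` vanishing at `0`, as a regularised lattice sum. -/
noncomputable def tanhSum (a x : ℝ) : ℝ :=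
  ∑' k : ℤ, (Real.tanh (a * (x + 2 * (k : ℝ) * π)) - Real.tanh (a * (0 + 2 * (k : ℝ) * π)))

lemma summable_and_hasDerivAt_tanhSum {a : ℝ} (ha : 0 < a) (x : ℝ) :
    (Summable fun k : ℤ =>
      Real.tanh (a * (x + 2 * (k : ℝ) * π)) - Real.tanh (a * (0 + 2 * (k : ℝ) * π))) ∧
    HasDerivAt (tanhSum a) (a * latticeSum sechSq a x) x :=
  summable_and_hasDerivAt_tsum_sub hasDerivAt_tanh quadDecay_sechSq ha
    (fun k : ℤ => Real.tanh (a * (0 + 2 * (k : ℝ) * π))) 0 (by simp) x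

lemma tanhSum_mul_latticeSum_sechSq {a : ℝ} (ha : 0 < a) (x : ℝ) :
    tanhSum a x * latticeSum sechSq a x =
      -(1 / 2) * latticeSum sechSqDeriv a x
        - 1 / (π * a) * latticeSum (fun u => u * sechSq u) a x
        + x / π * latticeSum sechSq a x := by
  set u : ℤ → ℝ := fun k => a * (x + 2 * (k : ℝ) * π) with hu
  set T : ℤ → ℝ := fun k => Real.tanh (u k) with hT
  set D : ℤ → ℝ := fun k => sechSq (u k) with hD
  have hpi := Real.pi_pos
  have hb : 0 < 2 * π * a := by positivity
  have hI : Tendsto (fun N : ℕ => Finset.Icc (-N : ℤ) N) atTop atTop := Finset.tendsto_Icc_neg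
  have hTlim : Tendsto (fun N : ℕ => ∑ j ∈ Finset.Icc (-N : ℤ) N, T j) atTop
      (𝓝 (tanhSum a x)) := by
    refine ((summable_and_hasDerivAt_tanhSum ha x).1.hasSum.comp hI).congr fun N => ?_
    simp only [Function.comp_apply, Finset.sum_sub_distrib]
    rw [sum_Icc_neg_eq_zero (F := fun k : ℤ => Real.tanh (a * (0 + 2 * (k : ℝ) * π))), sub_zero]
    intro j
    rw [← Real.tanh_neg]
    push_cast
    ring_nf
  have hDlim : Tendsto (fun N : ℕ => ∑ k ∈ Finset.Icc (-N : ℤ) N, D k) atTop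
      (𝓝 (latticeSum sechSq a x)) := (quadDecay_sechSq.summable ha x).hasSum.comp hI
  have hTDlim : Tendsto (fun N : ℕ => ∑ k ∈ Finset.Icc (-N : ℤ) N, T k * D k) atTop
      (𝓝 (-(1 / 2) * latticeSum sechSqDeriv a x)) := by
    refine (((quadDecay_sechSqDeriv.summable ha x).hasSum.mul_left (-(1 / 2))).comp hI).congr
      fun N => Finset.sum_congr rfl fun k _ => ?_
    simp only [hT, hD, hu, sechSqDeriv]
    ring
  have hkD : HasSum (fun k : ℤ => D k * (-2 * (k : ℝ)))
      (-(1 / (π * a)) * latticeSum (fun u => u * sechSq u) a x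
        + x / π * latticeSum sechSq a x) := by
    have h := ((quadDecay_id_mul_sechSq.summable ha x).hasSum.mul_left (-(1 / (π * a)))).add
      ((quadDecay_sechSq.summable ha x).hasSum.mul_left (x / π))
    refine h.congr_fun fun k => ?_
    simp only [hD, hu]
    field_simp
    ring
  have hClim : Tendsto (fun N : ℕ => ∑ k ∈ Finset.Icc (-N : ℤ) N, D k * cothSum (2 * π * a) N k)
      atTop (𝓝 (∑' k : ℤ, D k * (-2 * (k : ℝ)))) := by
    have heq : ∀ N : ℕ, ∑ k ∈ Finset.Icc (-N : ℤ) N, D k * cothSum (2 * π * a) N k =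
        ∑' k : ℤ, if k ∈ Finset.Icc (-N : ℤ) N then D k * cothSum (2 * π * a) N k else 0 :=
      fun N => by
        rw [tsum_eq_sum (s := Finset.Icc (-N : ℤ) N) fun k hk => if_neg hk]
        exact Finset.sum_congr rfl fun k hk => (if_pos hk).symm
    simp only [heq]
    refine tendsto_tsum_of_dominated_convergence
      (bound := fun k : ℤ => (1 + 1 / (2 * π * a)) * ‖D k * (-2 * (k : ℝ))‖)
      (hkD.summable.norm.mul_left _) (fun k => ?_) (Eventually.of_forall fun N k => ?_)
    · refine ((tendsto_cothSum hb k).const_mul (D k)).congr' ?_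
      filter_upwards [eventually_ge_atTop k.natAbs] with N hN
      rw [if_pos]
      simp only [Finset.mem_Icc]
      omega
    · have h0 : ‖D k * cothSum (2 * π * a) N k‖ ≤
          (1 + 1 / (2 * π * a)) * ‖D k * (-2 * (k : ℝ))‖ := by
        simp only [norm_mul, Real.norm_eq_abs, abs_neg, abs_two]
        have := mul_le_mul_of_nonneg_left (abs_cothSum_le hb N k) (abs_nonneg (D k))
        linarith
      split_ifs
      · exact h0
      · rw [norm_zero]
        exact (norm_nonneg _).trans h0
  have hfin : ∀ N : ℕ, (∑ j ∈ Finset.Icc (-N : ℤ) N, T j) * ∑ k ∈ Finset.Icc (-N : ℤ) N, D k =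
      ∑ k ∈ Finset.Icc (-N : ℤ) N, T k * D k +
        ∑ k ∈ Finset.Icc (-N : ℤ) N, D k * cothSum (2 * π * a) N k := fun N => by
    refine sum_mul_sum_eq_of_antisymm _ T D
      (fun j k => coth (2 * π * a * ((j - k : ℤ) : ℝ))) (fun j k => ?_) fun j k hjk => ?_
    · rw [← coth_neg]
      push_cast
      ring_nf
    · have hne : u k ≠ u j := fun h => hjk <| by
        have h' : a * (2 * π) * ((j : ℝ) - k) = 0 := by
          simp only [hu] at h
          linear_combination -h
        have : (j : ℝ) = k := by
          rcases mul_eq_zero.mp h' with h' | h'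
          · exact absurd h' (by positivity)
          · linarith
        exact_mod_cast this
      have h := sechSq_mul_tanh_add hne
      rw [show u j - u k = 2 * π * a * ((j - k : ℤ) : ℝ) by simp only [hu]; push_cast; ring] at h
      exact h
  have hlim := (hTDlim.add hClim).congr fun N => (hfin N).symm
  rw [tendsto_nhds_unique (hTlim.mul hDlim) hlim, hkD.tsum_eq]
  ring

lemma Jfun_eq_latticeSum (r x : ℝ) :
    Jfun r x = 2 * (π / (2 * r)) ^ 2 * latticeSum sechSq (π / (2 * r)) x := by
  have h : ∀ k : ℤ, π * (x + 2 * (k : ℝ) * π) / (2 * r) = π / (2 * r) * (x + 2 * (k : ℝ) * π) :=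
    fun k => mul_div_right_comm _ _ _
  simp only [Jfun, latticeSum, sechSq, h]
  ring

lemma hasDerivAt_HI_and_HI_eq {r : ℝ} (hr : 0 < r) (x : ℝ) :
    HasDerivAt (HI r) (Jfun r x - 1 / r) x ∧
      HI r x = 2 * (π / (2 * r)) * tanhSum (π / (2 * r)) x - x / r := by
  have ha : 0 < π / (2 * r) := by positivity
  have hprim : ∀ y, HasDerivAt (fun y => 2 * (π / (2 * r)) * tanhSum (π / (2 * r)) y - y / r)
      (Jfun r y - 1 / r) y := fun y => by
    have h := ((summable_and_hasDerivAt_tanhSum ha y).2.const_mul (2 * (π / (2 * r)))).sub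
      ((hasDerivAt_id' y).div_const r)
    convert! h using 1
    rw [Jfun_eq_latticeSum]
    ring
  have hcont : Continuous fun y => Jfun r y - 1 / r := by
    refine Continuous.sub (continuous_iff_continuousAt.mpr fun y => ?_) continuous_const
    rw [funext (Jfun_eq_latticeSum r)]
    exact ((hasDerivAt_latticeSum hasDerivAt_sechSq quadDecay_sechSq quadDecay_sechSqDeriv
      ha y).const_mul _).continuousAt
  refine ⟨hcont.integral_hasStrictDerivAt 0 x |>.hasDerivAt, ?_⟩
  rw [HI, intervalIntegral.integral_eq_sub_of_hasDerivAt (fun y _ => hprim y)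
    (hcont.intervalIntegrable _ _)]
  simp [tanhSum]

/-- The derivative of the product identity `tanhSum_mul_latticeSum_sechSq`. -/
lemma latticeSum_sechSq_sq_add {a : ℝ} (ha : 0 < a) (x : ℝ) :
    a * latticeSum sechSq a x ^ 2 + a * tanhSum a x * latticeSum sechSqDeriv a x =
      -(a / 2) * latticeSum sechSqDeriv₂ a x
        - 1 / π * latticeSum (fun u => u * sechSqDeriv u) a x
        + x * a / π * latticeSum sechSqDeriv a x := by
  have hS := hasDerivAt_latticeSum hasDerivAt_sechSq quadDecay_sechSq quadDecay_sechSqDeriv ha x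
  have hS' := hasDerivAt_latticeSum hasDerivAt_sechSqDeriv quadDecay_sechSqDeriv
    quadDecay_sechSqDeriv₂ ha x
  have hW := hasDerivAt_latticeSum hasDerivAt_id_mul_sechSq quadDecay_id_mul_sechSq
    (quadDecay_sechSq.add quadDecay_id_mul_sechSqDeriv) ha x
  have hadd : latticeSum (fun u => sechSq u + u * sechSqDeriv u) a x =
      latticeSum sechSq a x + latticeSum (fun u => u * sechSqDeriv u) a x :=
    (quadDecay_sechSq.summable ha x).tsum_add (quadDecay_id_mul_sechSqDeriv.summable ha x)
  have hl := (summable_and_hasDerivAt_tanhSum ha x).2.mul hS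
  have hr := ((hS'.const_mul (-(1 / 2))).sub (hW.const_mul (1 / (π * a)))).add
    (((hasDerivAt_id' x).div_const π).mul hS)
  have heq := hl.unique (hr.congr_of_eventuallyEq
    (Eventually.of_forall fun y => tanhSum_mul_latticeSum_sechSq ha y))
  rw [hadd] at heq
  have hpi := Real.pi_ne_zero
  have ha0 := ha.ne'
  field_simp at heq ⊢
  linear_combination heq

/-- For every `r > 0` and `x`, `J` is differentiable in `r` and twice differentiable
in `x`, `∂_x H_I(r,x) = J(r,x) - 1/r`, and `Φ(r,x) = r J(r,x)` satisfies
`∂_r Φ = ∂²_x Φ + H_I ∂_x Φ + (∂_x H_I) Φ`. -/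
theorem stmt18 (r : ℝ) (hr : 0 < r) (x : ℝ) :
    DifferentiableAt ℝ (fun s : ℝ => Jfun s x) r ∧
    DifferentiableAt ℝ (fun y : ℝ => Jfun r y) x ∧
    DifferentiableAt ℝ (deriv (fun y : ℝ => Jfun r y)) x ∧
    HasDerivAt (fun y : ℝ => HI r y) (Jfun r x - 1 / r) x ∧
    deriv (fun s : ℝ => s * Jfun s x) r
      = deriv (deriv (fun y : ℝ => r * Jfun r y)) x
        + HI r x * deriv (fun y : ℝ => r * Jfun r y) x
        + (Jfun r x - 1 / r) * (r * Jfun r x) := by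
  have hpi := Real.pi_pos
  have ha : 0 < π / (2 * r) := by positivity
  obtain ⟨hHI, hHI_eq⟩ := hasDerivAt_HI_and_HI_eq hr x
  have hS := hasDerivAt_latticeSum hasDerivAt_sechSq quadDecay_sechSq quadDecay_sechSqDeriv ha
  have hS' := hasDerivAt_latticeSum hasDerivAt_sechSqDeriv quadDecay_sechSqDeriv
    quadDecay_sechSqDeriv₂ ha
  have hJx : ∀ y, HasDerivAt (fun y => Jfun r y)
      (2 * (π / (2 * r)) ^ 2 * (π / (2 * r) * latticeSum sechSqDeriv (π / (2 * r)) y)) y :=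
    fun y => by
      simp only [Jfun_eq_latticeSum]
      exact (hS y).const_mul _
  have hJxx : HasDerivAt (deriv fun y => Jfun r y)
      (2 * (π / (2 * r)) ^ 2 * (π / (2 * r) *
        (π / (2 * r) * latticeSum sechSqDeriv₂ (π / (2 * r)) x))) x := by
    rw [funext fun y => (hJx y).deriv]
    exact ((hS' x).const_mul _).const_mul _
  have hscale : HasDerivAt (fun s : ℝ => π / (2 * s)) (-π / (2 * r ^ 2)) r := by
    have h := (hasDerivAt_inv hr.ne').const_mul (π / 2)
    convert! h using 1
    · ext s
      ring
    · ring
  have hJr : HasDerivAt (fun s => Jfun s x)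
      (2 * (2 * (π / (2 * r)) * (-π / (2 * r ^ 2))) * latticeSum sechSq (π / (2 * r)) x +
        2 * (π / (2 * r)) ^ 2 *
          (latticeSum (fun u => u * sechSqDeriv u) (π / (2 * r)) x / (π / (2 * r)) *
            (-π / (2 * r ^ 2)))) r := by
    simp only [Jfun_eq_latticeSum]
    have hpow : HasDerivAt (fun s : ℝ => (π / (2 * s)) ^ 2)
        (2 * (π / (2 * r)) * (-π / (2 * r ^ 2))) r := by
      simpa using hscale.fun_pow 2
    exact (hpow.const_mul 2).mul (HasDerivAt.comp (h₂ := fun b => latticeSum sechSq b x) r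
      (hasDerivAt_latticeSum_scale hasDerivAt_sechSq quadDecay_sechSq
        quadDecay_id_mul_sechSqDeriv ha x) hscale)
  refine ⟨hJr.differentiableAt, (hJx x).differentiableAt, hJxx.differentiableAt, hHI, ?_⟩
  have hΦx : ∀ y, deriv (fun y => r * Jfun r y) y = r * deriv (fun y => Jfun r y) y :=
    fun y => ((hJx y).differentiableAt.hasDerivAt.const_mul r).deriv
  rw [((hasDerivAt_id' r).fun_mul hJr).deriv, funext hΦx, (hJxx.const_mul r).deriv, hHI_eq]
  have hid := latticeSum_sechSq_sq_add ha x
  beta_reduce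
  rw [(hJx x).deriv]
  simp only [Jfun_eq_latticeSum]
  generalize latticeSum sechSq (π / (2 * r)) x = S at hid ⊢
  generalize latticeSum sechSqDeriv (π / (2 * r)) x = S₁ at hid ⊢
  generalize latticeSum sechSqDeriv₂ (π / (2 * r)) x = S₂ at hid ⊢
  generalize latticeSum (fun u => u * sechSqDeriv u) (π / (2 * r)) x = W at hid ⊢
  generalize tanhSum (π / (2 * r)) x = T at hid ⊢
  linear_combination (norm := (field_simp; ring)) (-2 * π * (π / (2 * r)) ^ 2) * hid
end
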